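/- arXiv:2511.04863 — 5 statements merged into one kernel-verified Lean document; each statement's English description precedes it below -/
import Mathlib

section
/- Let 𝓕_1, …, 𝓕_n be finite families of convex subsets of ℝ^d with ⋂ 𝓕_i = ∅ for each i ∈ {1,…,n}. If n ≥ d + 2, then the reconfiguration graph RG_CH(𝓕_1, …, 𝓕_n) is connected. -/
/-- A vertex of the colorful Helly reconfiguration graph `RG_CH(𝓕_1, …, 𝓕_n)`:
a tuple `(C_1, …, C_n)` with `C_i ∈ 𝓕_i` for all `i` and empty total intersection. -/
def CHVertex {d n : ℕ} (F : Fin n → Finset (Set (Fin d → ℝ)))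
    (c : Fin n → Set (Fin d → ℝ)) : Prop :=
  (∀ i, c i ∈ F i) ∧ (⋂ i, c i) = ∅

/-- Adjacency in `RG_CH(𝓕_1, …, 𝓕_n)`: two tuples are adjacent if they differ in
exactly one coordinate `j` and the intersection over the remaining coordinates is
already empty. -/
def CHAdj {d n : ℕ} (F : Fin n → Finset (Set (Fin d → ℝ)))
    (c e : Fin n → Set (Fin d → ℝ)) : Prop :=
  CHVertex F c ∧ CHVertex F e ∧
  ∃ j, c j ≠ e j ∧ (∀ i, i ≠ j → c i = e i) ∧
    (⋂ i, ⋂ (_ : i ≠ j), c i) = ∅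


/-- Abstract `d`-collapsibility of a finite set system. -/
inductive RGColl {V : Type*} [DecidableEq V] (d : ℕ) : Finset (Finset V) → Prop
  | empty : RGColl d ∅
  | step (X : Finset (Finset V)) (σ τ : Finset V) (hσ : σ ∈ X) (hd : σ.card ≤ d) (hτ : τ ∈ X)
      (h : ∀ ρ ∈ X, σ ⊆ ρ → ρ ⊆ τ) (hX : RGColl d (X.filter (fun ρ => ¬ σ ⊆ ρ))) : RGColl d X

section comb
variable {ι : Type*} [Fintype ι] [DecidableEq ι] {α : ι → Type*} [∀ i, Fintype (α i)]
  [∀ i, DecidableEq (α i)]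

/-- The graph of a full transversal. -/
def rgGr (c : ∀ i, α i) : Finset (Σ i, α i) := Finset.univ.filter (fun v => c v.1 = v.2)

/-- The graph of a transversal with colour `j` removed. -/
def rgGrE (c : ∀ i, α i) (j : ι) : Finset (Σ i, α i) :=
  Finset.univ.filter (fun v => c v.1 = v.2 ∧ v.1 ≠ j)

/-- Adjacency relative to a set system. -/
def rgAdj (X : Finset (Finset (Σ i, α i))) (c e : ∀ i, α i) : Prop :=
  ∃ j, (∀ i, i ≠ j → c i = e i) ∧ rgGrE c j ∉ X

lemma rgGrE_sub (c : ∀ i, α i) (j : ι) : rgGrE c j ⊆ rgGr c := by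
  intro v; simp [rgGrE, rgGr]; tauto

lemma rgGrE_congr (c e : ∀ i, α i) (j : ι) (h : ∀ i, i ≠ j → c i = e i) :
    rgGrE c j = rgGrE e j := by
  ext v
  simp only [rgGrE, Finset.mem_filter, Finset.mem_univ, true_and]
  constructor
  · rintro ⟨h1, h2⟩; exact ⟨by rw [← h _ h2]; exact h1, h2⟩
  · rintro ⟨h1, h2⟩; exact ⟨by rw [h _ h2]; exact h1, h2⟩

lemma rg_move (X : Finset (Finset (Σ i, α i))) (c e : ∀ i, α i)
    (h : ∀ w : ∀ i, α i, (∀ i, w i = c i ∨ w i = e i) → ∀ j, c j ≠ e j → rgGrE w j ∉ X) :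
    Relation.ReflTransGen (rgAdj X) c e := by
  have key : ∀ S : Finset ι, Relation.ReflTransGen (rgAdj X) c (S.piecewise e c) := by
    intro S
    induction S using Finset.induction_on with
    | empty => simp; exact Relation.ReflTransGen.refl
    | insert a S ha ih =>
      rw [Finset.piecewise_insert]
      by_cases hce : c a = e a
      · have : Function.update (S.piecewise e c) a (e a) = S.piecewise e c := by
          rw [Function.update_eq_self_iff]
          simp [Finset.piecewise, ha, hce]
        rw [this]; exact ih
      · refine ih.tail ⟨a, ?_, ?_⟩
        · intro i hi; rw [Function.update_of_ne hi]
        · apply h _ _ _ hce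
          intro i
          by_cases hi : i ∈ S <;> simp [Finset.piecewise, hi]
  simpa using key Finset.univ

lemma rg_move_bad (X : Finset (Finset (Σ i, α i))) (σ τ : Finset (Σ i, α i))
    (hs : ∀ ρ ∈ X, σ ⊆ ρ → ρ ⊆ τ) (c e : ∀ i, α i) (hc : σ ⊆ rgGr c) (he : σ ⊆ rgGr e)
    (k : ι) (hk : c k = e k) (hb : (⟨k, c k⟩ : Σ i, α i) ∉ τ) :
    Relation.ReflTransGen (rgAdj X) c e := by
  apply rg_move
  intro w hw j hj hX
  have h1 : σ ⊆ rgGrE w j := by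
    intro v hv
    have h2 := hc hv
    have h3 := he hv
    simp only [rgGr, rgGrE, Finset.mem_filter, Finset.mem_univ, true_and] at h2 h3 ⊢
    refine ⟨?_, ?_⟩
    · rcases hw v.1 with h | h <;> rw [h] <;> assumption
    · rintro rfl; exact hj (h2.trans h3.symm)
  apply hb
  apply hs _ hX h1
  simp only [rgGrE, Finset.mem_filter, Finset.mem_univ, true_and]
  refine ⟨?_, ?_⟩
  · rcases hw k with h | h <;> simp [h, hk]
  · rintro rfl; exact hj hk

lemma rg_link (X : Finset (Finset (Σ i, α i))) (σ τ : Finset (Σ i, α i)) (d : ℕ)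
    (hn : d + 2 ≤ Fintype.card ι) (hσ : σ.card ≤ d) (hστ : σ ⊆ τ)
    (hX : ∀ ρ ∈ X, ∀ ρ', ρ' ⊆ ρ → ρ' ∈ X) (hτ : τ ∈ X) (hF : ∀ i, ∃ a, (⟨i, a⟩ : Σ i, α i) ∉ τ)
    (hs : ∀ ρ ∈ X, σ ⊆ ρ → ρ ⊆ τ) (c e : ∀ i, α i) (hc : σ ⊆ rgGr c) (he : σ ⊆ rgGr e)
    (hcX : rgGr c ∉ X) (heX : rgGr e ∉ X) :
    Relation.ReflTransGen (rgAdj X) c e := by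
  have bad : ∀ c : ∀ i, α i, rgGr c ∉ X → ∃ k, (⟨k, c k⟩ : Σ i, α i) ∉ τ := by
    intro c hc
    by_contra! hcon
    apply hc
    apply hX τ hτ
    rintro ⟨i, a⟩ hv
    simp only [rgGr, Finset.mem_filter, Finset.mem_univ, true_and] at hv
    subst hv; exact hcon i
  have upd : ∀ (c : ∀ i, α i) (l : ι) (a : α l), σ ⊆ rgGr c → (∀ v ∈ σ, ∀ h : v.1 = l, h ▸ v.2 = a) →
      σ ⊆ rgGr (Function.update c l a) := by
    intro c l a hc hl v hv
    have h2 := hc hv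
    have h3 := hl v hv
    simp only [rgGr, Finset.mem_filter, Finset.mem_univ, true_and] at h2 ⊢
    by_cases h : v.1 = l
    · subst h; simpa using (h3 rfl).symm
    · rw [Function.update_of_ne h]; exact h2
  obtain ⟨k, hk⟩ := bad c hcX
  obtain ⟨k', hk'⟩ := bad e heX
  by_cases hkk : k = k'
  · subst hkk
    obtain ⟨l, hl⟩ : ∃ l, l ∉ insert k (σ.image Sigma.fst) := by
      by_contra! hcon
      have h1 : (Finset.univ : Finset ι).card ≤ (insert k (σ.image Sigma.fst)).card :=
        Finset.card_le_card (fun x _ => hcon x)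
      have h2 := Finset.card_insert_le k (σ.image Sigma.fst)
      have h3 : (σ.image Sigma.fst).card ≤ σ.card := Finset.card_image_le
      rw [Finset.card_univ] at h1
      omega
    rw [Finset.mem_insert, not_or] at hl
    obtain ⟨hlk, hl⟩ := hl
    obtain ⟨a, ha⟩ := hF l
    have hl' : ∀ v ∈ σ, ∀ h : v.1 = l, h ▸ v.2 = a := by
      intro v hv h
      exact absurd (Finset.mem_image.2 ⟨v, hv, h⟩) hl
    have hc' := upd c l a hc hl'
    have he' := upd e l a he hl'
    refine (rg_move_bad X σ τ hs c _ hc hc' k ?_ hk).trans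
      ((rg_move_bad X σ τ hs _ _ hc' he' l ?_ ?_).trans
        (rg_move_bad X σ τ hs _ e he' he k ?_ ?_))
    · rw [Function.update_of_ne (Ne.symm hlk)]
    · simp
    · simpa using ha
    · rw [Function.update_of_ne (Ne.symm hlk)]
    · rw [Function.update_of_ne (Ne.symm hlk)]; exact hk'
  · have hm : σ ⊆ rgGr (Function.update c k' (e k')) := by
      apply upd c k' _ hc
      rintro v hv h
      have := he hv
      simp only [rgGr, Finset.mem_filter, Finset.mem_univ, true_and] at this
      subst h; exact this.symm
    refine (rg_move_bad X σ τ hs c _ hc hm k ?_ hk).trans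
        (rg_move_bad X σ τ hs _ e hm he k' ?_ ?_)
    · rw [Function.update_of_ne hkk]
    · simp
    · simpa using hk'

theorem rg_comb (d : ℕ) (hn : d + 2 ≤ Fintype.card ι) (X : Finset (Finset (Σ i, α i)))
    (hcoll : RGColl d X) (hX : ∀ ρ ∈ X, ∀ ρ', ρ' ⊆ ρ → ρ' ∈ X)
    (hF : ∀ τ ∈ X, ∀ i, ∃ a, (⟨i, a⟩ : Σ i, α i) ∉ τ) (c e : ∀ i, α i)
    (hc : rgGr c ∉ X) (he : rgGr e ∉ X) : Relation.ReflTransGen (rgAdj X) c e := by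
  induction hcoll with
  | empty => exact rg_move _ _ _ (by simp)
  | step X σ τ hσ hd hτ hs _ ih =>
    have hX' : ∀ ρ ∈ X.filter (fun ρ => ¬ σ ⊆ ρ), ∀ ρ', ρ' ⊆ ρ →
        ρ' ∈ X.filter (fun ρ => ¬ σ ⊆ ρ) := by
      intro ρ hρ ρ' hρ'
      rw [Finset.mem_filter] at hρ ⊢
      exact ⟨hX _ hρ.1 _ hρ', fun h => hρ.2 (h.trans hρ')⟩
    have path := ih hX' (fun τ hτ => hF τ (Finset.mem_filter.1 hτ).1)
      (fun h => hc (Finset.mem_filter.1 h).1) (fun h => he (Finset.mem_filter.1 h).1)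
    have link := rg_link X σ τ d hn hd (hs _ hσ subset_rfl) hX hτ (hF τ hτ) hs
    have inv : (rgGr e ∉ X → Relation.ReflTransGen (rgAdj X) c e) ∧ (rgGr e ∈ X →
        ∀ w, rgGr w ∉ X → σ ⊆ rgGr w → Relation.ReflTransGen (rgAdj X) c w) := by
      clear he ih
      induction path with
      | refl => exact ⟨fun _ => Relation.ReflTransGen.refl, fun h => absurd h hc⟩
      | @tail b f _ hbf ih =>
        obtain ⟨j, hj, hjX⟩ := hbf
        by_cases hρ : rgGrE b j ∈ X
        · have hσρ : σ ⊆ rgGrE b j := by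
            by_contra h
            exact hjX (Finset.mem_filter.2 ⟨hρ, h⟩)
          have hσb := hσρ.trans (rgGrE_sub b j)
          have hσf : σ ⊆ rgGr f := by
            rw [rgGrE_congr b f j hj] at hσρ
            exact hσρ.trans (rgGrE_sub f j)
          have all : ∀ w, rgGr w ∉ X → σ ⊆ rgGr w → Relation.ReflTransGen (rgAdj X) c w := by
            intro w hw hσw
            by_cases hb : rgGr b ∈ X
            · exact ih.2 hb w hw hσw
            · exact (ih.1 hb).trans (link b w hσb hσw hb hw)
          exact ⟨fun h => all f h hσf, fun _ => all⟩
        · have hb : rgGr b ∉ X := fun h => hρ (hX _ h _ (rgGrE_sub b j))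
          have hf : rgGr f ∉ X := fun h => hρ (by
            rw [rgGrE_congr b f j hj]; exact hX _ h _ (rgGrE_sub f j))
          exact ⟨fun _ => (ih.1 hb).tail ⟨j, hj, hρ⟩, fun h => absurd h hf⟩
    exact inv.1 he
end comb

theorem rg_coll_of_m {V : Type*} [DecidableEq V] (d : ℕ) (N : Finset (Finset V))
    (m : Finset V → ℝ) (hN : ∀ ρ ∈ N, ∀ ρ', ρ' ⊆ ρ → ρ' ∈ N)
    (hm : ∀ ρ ∈ N, ∀ ρ', ρ' ⊆ ρ → m ρ' ≤ m ρ)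
    (hbasis : ∀ ρ ∈ N, ∃ σ, σ ⊆ ρ ∧ σ.card ≤ d ∧ m σ = m ρ)
    (hgen : ∀ σ ∈ N, ∀ σ' ∈ N, ∀ v ∈ σ, v ∉ σ' → m (σ.erase v) < m σ → m σ ≠ m σ')
    (hunion : ∀ σ ∈ N, ∃ τ ∈ N, m τ = m σ ∧ ∀ ρ ∈ N, σ ⊆ ρ → m ρ = m σ → ρ ⊆ τ) :
    RGColl d N := by
  have key : ∀ k : ℕ, ∀ X : Finset (Finset V), X ⊆ N → X.card ≤ k →
      (∀ ρ ∈ N, ∀ ρ' ∈ X, m ρ ≤ m ρ' → ρ ∈ X) → RGColl d X := by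
    intro k
    induction k with
    | zero =>
      intro X _ hk _
      have : X = ∅ := by simpa using hk
      rw [this]; exact RGColl.empty
    | succ k ih =>
      intro X hXN hk hX
      rcases X.eq_empty_or_nonempty with rfl | hne
      · exact RGColl.empty
      obtain ⟨ρ₀, hρ₀, hmax⟩ := Finset.exists_max_image X m hne
      obtain ⟨σ, hσ⟩ := Finset.exists_minimal
        (s := X.filter (fun ρ => m ρ = m ρ₀)) ⟨ρ₀, by simp [hρ₀]⟩
      have hσX : σ ∈ X := (Finset.mem_filter.1 hσ.1).1
      have hσm : m σ = m ρ₀ := (Finset.mem_filter.1 hσ.1).2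
      have hmin : ∀ σ₁, σ₁ ⊆ σ → m σ₁ = m σ → σ₁ = σ := by
        intro σ₁ h1 h2
        have h3 : σ₁ ∈ X := hX _ (hN _ (hXN hσX) _ h1) _ hσX h2.le
        exact Finset.Subset.antisymm h1
          (hσ.2 (Finset.mem_filter.2 ⟨h3, h2.trans hσm⟩) h1)
      have hcard : σ.card ≤ d := by
        obtain ⟨σ₁, h1, h2, h3⟩ := hbasis σ (hXN hσX)
        rw [← hmin σ₁ h1 h3]; exact h2
      obtain ⟨τ, hτN, hτm, hτ⟩ := hunion σ (hXN hσX)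
      have hsup : ∀ ρ ∈ X, σ ⊆ ρ → m ρ = m σ := by
        intro ρ hρ hs
        exact le_antisymm (by rw [hσm]; exact hmax ρ hρ) (hm ρ (hXN hρ) σ hs)
      refine RGColl.step X σ τ hσX hcard (hX τ hτN σ hσX hτm.le)
        (fun ρ hρ hs => hτ ρ (hXN hρ) hs (hsup ρ hρ hs)) ?_
      apply ih
      · exact (Finset.filter_subset _ _).trans hXN
      · have : (X.filter (fun ρ => ¬ σ ⊆ ρ)).card < X.card := by
          apply Finset.card_lt_card
          rw [Finset.filter_ssubset]
          exact ⟨σ, hσX, by simp⟩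
        omega
      · intro ρ hρ ρ' hρ' hle
        rw [Finset.mem_filter] at hρ' ⊢
        have hρX := hX ρ hρ ρ' hρ'.1 hle
        refine ⟨hρX, fun hs => ?_⟩
        have h1 := hsup ρ hρX hs
        have h2 : m σ = m ρ' := le_antisymm (h1 ▸ hle) (by rw [hσm]; exact hmax _ hρ'.1)
        obtain ⟨v, hv, hv'⟩ := Finset.not_subset.1 hρ'.2
        refine hgen σ (hXN hσX) ρ' (hXN hρ'.1) v hv hv' ?_ h2
        refine lt_of_le_of_ne (hm σ (hXN hσX) _ (Finset.erase_subset _ _)) ?_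
        intro h
        have := hmin _ (Finset.erase_subset _ _) h
        rw [Finset.erase_eq_self] at this
        exact this hv
  refine key _ N subset_rfl le_rfl (fun ρ hρ _ _ _ => hρ)

theorem rg_generic {V κ : Type*} [Fintype V] [Fintype κ] (B : κ → (V → ℝ) → Prop) (v : κ → V)
    (hB : ∀ k t t', (∀ u, 0 ≤ t u) → (∀ u, u ≠ v k → t u = t' u) → t (v k) < t' (v k) →
      B k t → ¬ B k t') (δ : ℝ) (hδ : 0 < δ) :
    ∃ t : V → ℝ, (∀ u, 0 ≤ t u ∧ t u ≤ δ) ∧ ∀ k, ¬ B k t := by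
  classical
  obtain ⟨G, hG, hGc⟩ := (Set.Icc_infinite hδ).exists_subset_card_eq (Fintype.card κ + 1)
  by_contra! hcon
  set P : Finset (V → ℝ) := Fintype.piFinset (fun _ => G) with hP
  have hPm : ∀ t ∈ P, ∀ u, 0 ≤ t u ∧ t u ≤ δ := by
    intro t ht u
    exact hG (Fintype.mem_piFinset.1 ht u)
  have hcov : P ⊆ Finset.univ.biUnion (fun k => P.filter (B k)) := by
    intro t ht
    obtain ⟨k, hk⟩ := hcon t (hPm t ht)
    simp only [Finset.mem_biUnion, Finset.mem_filter, Finset.mem_univ, true_and]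
    exact ⟨k, ht, hk⟩
  have hone : ∀ k, (P.filter (B k)).card * (Fintype.card κ + 1) ≤ P.card := by
    intro k
    rw [← hGc, ← Finset.card_product]
    apply Finset.card_le_card_of_injOn (fun x => Function.update x.1 (v k) x.2)
    · intro x hx
      simp only [Finset.coe_product, Set.mem_prod, Finset.mem_coe, Finset.mem_filter] at hx
      simp only [Finset.mem_coe, hP, Fintype.mem_piFinset]
      intro u
      by_cases h : u = v k
      · subst h; simpa using hx.2
      · rw [Function.update_of_ne h]; exact Fintype.mem_piFinset.1 hx.1.1 u
    · rintro ⟨t, g⟩ hx ⟨t', g'⟩ hx' heq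
      simp only [Finset.coe_product, Set.mem_prod, Finset.mem_coe, Finset.mem_filter] at hx hx'
      simp only at heq
      have hg : g = g' := by simpa using congrFun heq (v k)
      have hoff : ∀ u, u ≠ v k → t u = t' u := by
        intro u hu
        simpa [Function.update_of_ne hu] using congrFun heq u
      have hon : t (v k) = t' (v k) := by
        rcases lt_trichotomy (t (v k)) (t' (v k)) with h | h | h
        · exact absurd hx'.1.2 (hB k t t' (fun u => (hPm t hx.1.1 u).1) hoff h hx.1.2)
        · exact h
        · exact absurd hx.1.2 (hB k t' t (fun u => (hPm t' hx'.1.1 u).1)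
            (fun u hu => (hoff u hu).symm) h hx'.1.2)
      have : t = t' := by
        funext u
        by_cases h : u = v k
        · subst h; exact hon
        · exact hoff u h
      rw [this, hg]
  have h1 : P.card ≤ ∑ k, (P.filter (B k)).card :=
    (Finset.card_le_card hcov).trans Finset.card_biUnion_le
  have h2 : (∑ k, (P.filter (B k)).card) * (Fintype.card κ + 1) ≤ Fintype.card κ * P.card := by
    rw [Finset.sum_mul]
    calc _ ≤ ∑ k : κ, P.card := Finset.sum_le_sum (fun k _ => hone k)
      _ = _ := by simp
  have h3 : 0 < P.card := by
    rw [hP, Fintype.card_piFinset]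
    apply Finset.prod_pos
    intro _ _; omega
  nlinarith

section geom
variable {E : Type*} [NormedAddCommGroup E] [InnerProductSpace ℝ E] [FiniteDimensional ℝ E]

/-- Thickened intersection. -/
def rgK {V : Type*} (K : V → Set E) (t : V → ℝ) (ρ : Finset V) : Set E :=
  ⋂ v ∈ ρ, Metric.cthickening (t v) (K v)

lemma rgK_closed {V : Type*} (K : V → Set E) (t : V → ℝ) (ρ : Finset V) :
    IsClosed (rgK K t ρ) :=
  isClosed_biInter (fun _ _ => Metric.isClosed_cthickening)

lemma rgK_convex {V : Type*} (K : V → Set E) (hK : ∀ v, Convex ℝ (K v)) (t : V → ℝ)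
    (ρ : Finset V) : Convex ℝ (rgK K t ρ) :=
  convex_iInter₂ (fun v _ => (hK v).cthickening _)

lemma rgK_anti {V : Type*} (K : V → Set E) (t : V → ℝ) {ρ ρ' : Finset V} (h : ρ' ⊆ ρ) :
    rgK K t ρ ⊆ rgK K t ρ' :=
  Set.biInter_subset_biInter_left h

lemma rgK_congr {V : Type*} (K : V → Set E) (t t' : V → ℝ) (ρ : Finset V)
    (h : ∀ v ∈ ρ, t v = t' v) : rgK K t ρ = rgK K t' ρ := by
  unfold rgK
  exact Set.iInter₂_congr (fun v hv => by rw [h v hv])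

/-- Norm of the minimal point. -/
noncomputable def rgM {V : Type*} (K : V → Set E) (t : V → ℝ) (ρ : Finset V) : ℝ :=
  Metric.infDist 0 (rgK K t ρ)

lemma rgM_exists {V : Type*} (K : V → Set E) (t : V → ℝ) (ρ : Finset V)
    (h : (rgK K t ρ).Nonempty) : ∃ p ∈ rgK K t ρ, ‖p‖ = rgM K t ρ := by
  obtain ⟨p, hp, h2⟩ := (rgK_closed K t ρ).exists_infDist_eq_dist h 0
  exact ⟨p, hp, by rw [rgM, h2, dist_zero_left]⟩

lemma rgM_le {V : Type*} (K : V → Set E) (t : V → ℝ) (ρ : Finset V) {x : E}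
    (h : x ∈ rgK K t ρ) : rgM K t ρ ≤ ‖x‖ := by
  have := Metric.infDist_le_dist_of_mem (x := (0 : E)) h
  rwa [dist_zero_left] at this

lemma rgM_mono {V : Type*} (K : V → Set E) (t : V → ℝ) {ρ ρ' : Finset V} (h : ρ' ⊆ ρ)
    (hne : (rgK K t ρ).Nonempty) : rgM K t ρ' ≤ rgM K t ρ :=
  Metric.infDist_le_infDist_of_subset (rgK_anti K t h) hne

lemma rg_basis {V : Type*} [DecidableEq V] (K : V → Set E) (hK : ∀ v, Convex ℝ (K v)) (t : V → ℝ)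
    (ρ : Finset V) (hne : (rgK K t ρ).Nonempty) :
    ∃ σ, σ ⊆ ρ ∧ σ.card ≤ Module.finrank ℝ E ∧ rgM K t σ = rgM K t ρ := by
  by_contra! hcon
  have hlt : ∀ σ, σ ⊆ ρ → σ.card ≤ Module.finrank ℝ E →
      ∃ p ∈ rgK K t σ, ‖p‖ < rgM K t ρ := by
    intro σ h1 h2
    obtain ⟨p, hp, h3⟩ := rgM_exists K t σ (hne.mono (rgK_anti K t h1))
    exact ⟨p, hp, h3 ▸ lt_of_le_of_ne (rgM_mono K t h1 hne) (hcon σ h1 h2)⟩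
  let F : Option V → Set E := fun o =>
    o.elim (Metric.ball 0 (rgM K t ρ)) (fun v => Metric.cthickening (t v) (K v))
  have hel := Convex.helly_theorem' (𝕜 := ℝ) (F := F) (s := Finset.insertNone ρ) ?_ ?_
  · obtain ⟨x, hx⟩ := hel
    rw [Set.mem_iInter₂] at hx
    have h1 : x ∈ rgK K t ρ := by
      refine Set.mem_iInter₂.2 (fun v hv => ?_)
      exact hx (some v) (by simpa using hv)
    have h2 : x ∈ Metric.ball (0 : E) (rgM K t ρ) := hx none (by simp)
    rw [mem_ball_zero_iff] at h2
    exact absurd (rgM_le K t ρ h1) (not_le.2 h2)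
  · rintro (_ | v) _
    · exact convex_ball _ _
    · exact (hK v).cthickening _
  · intro I hI hc
    have hsub : Finset.eraseNone I ⊆ ρ := by
      intro v hv
      have := hI (Finset.mem_eraseNone.1 hv)
      simpa using this
    by_cases hn : none ∈ I
    · have h1 := Finset.card_eraseNone_of_mem hn
      obtain ⟨p, hp, hlt⟩ := hlt _ hsub (by omega)
      refine ⟨p, Set.mem_iInter₂.2 ?_⟩
      rintro (_ | v) hv
      · exact mem_ball_zero_iff.2 hlt
      · exact Set.mem_iInter₂.1 hp v (Finset.mem_eraseNone.2 hv)
    · obtain ⟨p, hp⟩ := hne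
      refine ⟨p, Set.mem_iInter₂.2 ?_⟩
      rintro (_ | v) hv
      · exact absurd hv hn
      · exact Set.mem_iInter₂.1 hp v (hsub (Finset.mem_eraseNone.2 hv))

lemma rg_strict {V : Type*} [DecidableEq V] (K : V → Set E) (hK : ∀ v, Convex ℝ (K v))
    (t t' : V → ℝ) (σ : Finset V) (v : V) (hv : v ∈ σ) (ht : 0 ≤ t v)
    (hoff : ∀ u, u ≠ v → t u = t' u) (hlt : t v < t' v) (hne : (rgK K t σ).Nonempty)
    (h : rgM K t (σ.erase v) < rgM K t σ) : rgM K t' σ < rgM K t σ := by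
  obtain ⟨x, hx, hxn⟩ := rgM_exists K t σ hne
  obtain ⟨y, hy, hyn⟩ := rgM_exists K t (σ.erase v)
    (hne.mono (rgK_anti K t (Finset.erase_subset _ _)))
  obtain ⟨l, hl0, hl1, hld⟩ : ∃ l : ℝ, 0 < l ∧ l ≤ 1 ∧ l * ‖y - x‖ ≤ t' v - t v := by
    refine ⟨min 1 ((t' v - t v) / (‖y - x‖ + 1)), ?_, min_le_left _ _, ?_⟩
    · apply lt_min one_pos
      apply div_pos (by linarith) (by positivity)
    · have h1 : (0 : ℝ) < ‖y - x‖ + 1 := by positivity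
      calc _ ≤ ((t' v - t v) / (‖y - x‖ + 1)) * (‖y - x‖ + 1) := by
            apply mul_le_mul (min_le_right _ _) (by linarith) (norm_nonneg _)
            exact div_nonneg (by linarith) h1.le
        _ = _ := by field_simp
  have hz : (1 - l) • x + l • y ∈ rgK K t' σ := by
    refine Set.mem_iInter₂.2 (fun u hu => ?_)
    have hxu := Set.mem_iInter₂.1 hx u hu
    by_cases huv : u = v
    · subst huv
      have h1 : (1 - l) • x + l • y ∈
          Metric.cthickening (t' u - t u) (Metric.cthickening (t u) (K u)) := by
        apply Metric.mem_cthickening_of_dist_le _ x _ _ hxu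
        rw [dist_eq_norm]
        have : (1 - l) • x + l • y - x = l • (y - x) := by module
        rw [this, norm_smul, Real.norm_of_nonneg hl0.le]; exact hld
      have h2 := Metric.cthickening_cthickening_subset (by linarith) ht _ h1
      simpa using h2
    · have hyu := Set.mem_iInter₂.1 hy u (Finset.mem_erase.2 ⟨huv, hu⟩)
      rw [← hoff u huv]
      exact (hK u).cthickening _ hxu hyu (by linarith) hl0.le (by ring)
  calc rgM K t' σ ≤ ‖(1 - l) • x + l • y‖ := rgM_le K t' σ hz
    _ ≤ ‖(1 - l) • x‖ + ‖l • y‖ := norm_add_le _ _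
    _ = (1 - l) * rgM K t σ + l * rgM K t (σ.erase v) := by
      rw [norm_smul, norm_smul, Real.norm_of_nonneg hl0.le,
        Real.norm_of_nonneg (by linarith), hxn, hyn]
    _ < rgM K t σ := by nlinarith

lemma rg_delta {V : Type*} [Fintype V] (K : V → Set E) (hK : ∀ v, IsCompact (K v)) :
    ∃ δ > 0, ∀ t : V → ℝ, (∀ v, t v ≤ δ) → ∀ ρ : Finset V,
      (rgK K t ρ).Nonempty → (⋂ v ∈ ρ, K v).Nonempty := by
  have one : ∀ ρ : Finset V, ∃ k : ℕ, (rgK K (fun _ => 1 / ((k : ℝ) + 1)) ρ).Nonempty →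
      (⋂ v ∈ ρ, K v).Nonempty := by
    intro ρ
    by_contra! hcon
    rcases ρ.eq_empty_or_nonempty with rfl | ⟨v₀, hv₀⟩
    · have := (hcon 0).2
      simp at this
    obtain ⟨x, hx⟩ := IsCompact.nonempty_iInter_of_sequence_nonempty_isCompact_isClosed
      (fun k : ℕ => rgK K (fun _ => 1 / ((k : ℝ) + 1)) ρ) (by
        intro k
        refine Set.iInter₂_mono (fun v _ => Metric.cthickening_mono ?_ _)
        apply one_div_le_one_div_of_le (by positivity)
        push_cast; linarith) (fun k => (hcon k).1)
      (((hK v₀).cthickening).of_isClosed_subset (rgK_closed _ _ _)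
        (Set.biInter_subset_of_mem hv₀)) (fun k => rgK_closed _ _ _)
    have hx' : x ∈ ⋂ v ∈ ρ, K v := by
      refine Set.mem_iInter₂.2 (fun v hv => ?_)
      rw [← (hK v).isClosed.closure_eq, Metric.closure_eq_iInter_cthickening]
      refine Set.mem_iInter₂.2 (fun δ hδ => ?_)
      obtain ⟨k, hk⟩ := exists_nat_one_div_lt hδ
      exact Metric.cthickening_mono hk.le _
        (Set.mem_iInter₂.1 (Set.mem_iInter.1 hx k) v hv)
    rw [(hcon 0).2] at hx'
    exact hx'
  choose k hk using one
  refine ⟨1 / (((Finset.univ.sup k : ℕ) : ℝ) + 1), by positivity, ?_⟩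
  intro t ht ρ hne
  apply hk ρ
  refine hne.mono (Set.iInter₂_mono (fun v _ => Metric.cthickening_mono ((ht v).trans ?_) _))
  apply one_div_le_one_div_of_le (by positivity)
  have : k ρ ≤ Finset.univ.sup k := Finset.le_sup (Finset.mem_univ ρ)
  have : (k ρ : ℝ) ≤ ((Finset.univ.sup k : ℕ) : ℝ) := by exact_mod_cast this
  linarith

theorem rg_nerve {V : Type*} [Fintype V] [DecidableEq V] (A : V → Set E)
    (hA : ∀ v, Convex ℝ (A v)) (N : Finset (Finset V))
    (hN : ∀ ρ, ρ ∈ N ↔ (⋂ v ∈ ρ, A v).Nonempty) : RGColl (Module.finrank ℝ E) N := by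
  classical
  have hq : ∀ ρ : Finset V, ∃ q : E, ρ ∈ N → q ∈ ⋂ v ∈ ρ, A v := by
    intro ρ
    by_cases h : ρ ∈ N
    · obtain ⟨q, hq⟩ := (hN ρ).1 h
      exact ⟨q, fun _ => hq⟩
    · exact ⟨0, fun h' => absurd h' h⟩
  choose q hq using hq
  let K : V → Set E := fun v => convexHull ℝ (q '' {ρ | ρ ∈ N ∧ v ∈ ρ})
  have hKc : ∀ v, Convex ℝ (K v) := fun v => convex_convexHull _ _
  have hKk : ∀ v, IsCompact (K v) := fun v =>
    Set.Finite.isCompact_convexHull ℝ (Set.Finite.image _ (Set.toFinite _))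
  have hKA : ∀ v, K v ⊆ A v := by
    intro v
    apply convexHull_min _ (hA v)
    rintro _ ⟨ρ, ⟨h1, h2⟩, rfl⟩
    exact Set.mem_iInter₂.1 (hq ρ h1) v h2
  obtain ⟨δ, hδ, hδK⟩ := rg_delta K hKk
  have hNK : ∀ t : V → ℝ, ∀ ρ ∈ N, (rgK K t ρ).Nonempty := by
    intro t ρ hρ
    refine ⟨q ρ, Set.mem_iInter₂.2 (fun v hv => ?_)⟩
    apply Metric.self_subset_cthickening
    exact subset_convexHull _ _ ⟨ρ, ⟨hρ, hv⟩, rfl⟩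
  obtain ⟨t, ht, htB⟩ := rg_generic (V := V) (κ := Finset V × Finset V × V)
    (fun k t => k.1 ∈ N ∧ k.2.2 ∈ k.1 ∧ k.2.2 ∉ k.2.1 ∧
      rgM K t (k.1.erase k.2.2) < rgM K t k.1 ∧ rgM K t k.1 = rgM K t k.2.1) (fun k => k.2.2)
    (by
      rintro ⟨σ, σ', v⟩ t t' ht0 hoff hlt ⟨h1, h2, h3, h4, h5⟩ ⟨-, -, -, -, h5'⟩
      simp only at *
      have hs := rg_strict K hKc t t' σ v h2 (ht0 v) hoff hlt (hNK t σ h1) h4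
      have : rgM K t σ' = rgM K t' σ' := by
        unfold rgM
        rw [rgK_congr K t t' σ' (fun u hu => hoff u (by rintro rfl; exact h3 hu))]
      rw [h5, this, ← h5'] at hs
      exact lt_irrefl _ hs) δ hδ
  have hKN : ∀ ρ, (rgK K t ρ).Nonempty → ρ ∈ N := by
    intro ρ hρ
    rw [hN]
    exact (hδK t (fun v => (ht v).2) ρ hρ).mono (Set.iInter₂_mono (fun v _ => hKA v))
  apply rg_coll_of_m _ N (rgM K t)
  · intro ρ hρ ρ' h
    exact hKN ρ' ((hNK t ρ hρ).mono (rgK_anti K t h))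
  · intro ρ hρ ρ' h
    exact rgM_mono K t h (hNK t ρ hρ)
  · intro ρ hρ
    exact rg_basis K hKc t ρ (hNK t ρ hρ)
  · intro σ hσ σ' _ v hv hv' hlt heq
    exact htB (σ, σ', v) ⟨hσ, hv, hv', hlt, heq⟩
  · intro σ hσ
    obtain ⟨p, hp, hpn⟩ := rgM_exists K t σ (hNK t σ hσ)
    let τ : Finset V := Finset.univ.filter (fun v => p ∈ Metric.cthickening (t v) (K v))
    have hpτ : p ∈ rgK K t τ :=
      Set.mem_iInter₂.2 (fun v hv => (Finset.mem_filter.1 hv).2)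
    have hτN : τ ∈ N := hKN τ ⟨p, hpτ⟩
    have hστ : σ ⊆ τ := fun v hv =>
      Finset.mem_filter.2 ⟨Finset.mem_univ _, Set.mem_iInter₂.1 hp v hv⟩
    refine ⟨τ, hτN, le_antisymm ?_ (rgM_mono K t hστ ⟨p, hpτ⟩), ?_⟩
    · rw [← hpn]; exact rgM_le K t τ hpτ
    · intro ρ hρ hs hm
      obtain ⟨p', hp', hpn'⟩ := rgM_exists K t ρ (hNK t ρ hρ)
      have hpp : p = p' := by
        by_contra hne
        have h1 := norm_combo_lt_of_ne hpn.le (hpn'.trans hm).le hne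
          (a := 1 / 2) (b := 1 / 2) (by norm_num) (by norm_num) (by norm_num)
        have h2 := rgK_convex K hKc t σ hp (rgK_anti K t hs hp') (a := 1 / 2) (b := 1 / 2)
          (by norm_num) (by norm_num) (by norm_num)
        exact absurd (rgM_le K t σ h2) (not_le.2 h1)
      intro v hv
      refine Finset.mem_filter.2 ⟨Finset.mem_univ _, ?_⟩
      rw [hpp]
      exact Set.mem_iInter₂.1 hp' v hv
end geom
/-- Reconfiguration version of the colorful Helly theorem: if each family `𝓕_i`
consists of convex subsets of `ℝ^d` with empty intersection and `n ≥ d + 2`, then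
the reconfiguration graph `RG_CH(𝓕_1, …, 𝓕_n)` is connected. -/
theorem stmt_3 {d n : ℕ} (F : Fin n → Finset (Set (Fin d → ℝ)))
    (hconv : ∀ i, ∀ C ∈ F i, Convex ℝ C)
    (hempty : ∀ i, ⋂₀ ((F i : Set (Set (Fin d → ℝ)))) = ∅)
    (hn : d + 2 ≤ n)
    (c e : Fin n → Set (Fin d → ℝ))
    (hc : CHVertex F c) (he : CHVertex F e) :
    Relation.ReflTransGen (CHAdj F) c e := by
  classical
  let L : EuclideanSpace ℝ (Fin d) ≃ₗ[ℝ] (Fin d → ℝ) := WithLp.linearEquiv 2 ℝ (Fin d → ℝ)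
  let α : Fin n → Type := fun i => {C // C ∈ F i}
  let A : (Σ i, α i) → Set (Fin d → ℝ) := fun v => v.2.1
  let N : Finset (Finset (Σ i, α i)) := Finset.univ.filter (fun ρ => (⋂ v ∈ ρ, A v).Nonempty)
  have hNm : ∀ ρ, ρ ∈ N ↔ (⋂ v ∈ ρ, A v).Nonempty := by intro ρ; simp [N]
  have hcoll : RGColl d N := by
    have := rg_nerve (fun v => L ⁻¹' (A v))
      (fun v => (hconv v.1 _ v.2.2).linear_preimage L.toLinearMap) N (by
        intro ρ
        rw [hNm]
        constructor
        · rintro ⟨x, hx⟩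
          refine ⟨L.symm x, Set.mem_iInter₂.2 (fun v hv => ?_)⟩
          simpa using Set.mem_iInter₂.1 hx v hv
        · rintro ⟨x, hx⟩
          exact ⟨L x, Set.mem_iInter₂.2 (fun v hv => Set.mem_iInter₂.1 hx v hv)⟩)
    simpa using this
  have hlow : ∀ ρ ∈ N, ∀ ρ', ρ' ⊆ ρ → ρ' ∈ N := by
    intro ρ hρ ρ' h
    rw [hNm] at hρ ⊢
    exact hρ.mono (Set.biInter_subset_biInter_left h)
  have hF : ∀ τ ∈ N, ∀ i, ∃ a, (⟨i, a⟩ : Σ i, α i) ∉ τ := by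
    intro τ hτ i
    by_contra! hcon
    obtain ⟨x, hx⟩ := (hNm τ).1 hτ
    have : x ∈ ⋂₀ ((F i : Set (Set (Fin d → ℝ)))) := by
      intro C hC
      exact Set.mem_iInter₂.1 hx ⟨i, ⟨C, hC⟩⟩ (hcon _)
    rw [hempty i] at this
    exact this
  have hgr : ∀ c : ∀ i, α i, rgGr c ∉ N ↔ (⋂ i, (c i).1) = ∅ := by
    intro c
    rw [hNm, Set.not_nonempty_iff_eq_empty]
    have : (⋂ v ∈ rgGr c, A v) = ⋂ i, (c i).1 := by
      ext x
      simp only [Set.mem_iInter, rgGr, Finset.mem_filter, Finset.mem_univ, true_and]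
      constructor
      · intro h i; exact h ⟨i, c i⟩ rfl
      · rintro h ⟨i, a⟩ hv
        simp only at hv
        subst hv; exact h i
    rw [this]
  have hgrE : ∀ (c : ∀ i, α i) (j : Fin n), rgGrE c j ∉ N ↔
      (⋂ i, ⋂ (_ : i ≠ j), (c i).1) = ∅ := by
    intro c j
    rw [hNm, Set.not_nonempty_iff_eq_empty]
    have : (⋂ v ∈ rgGrE c j, A v) = ⋂ i, ⋂ (_ : i ≠ j), (c i).1 := by
      ext x
      simp only [Set.mem_iInter, rgGrE, Finset.mem_filter, Finset.mem_univ, true_and]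
      constructor
      · intro h i hi; exact h ⟨i, c i⟩ ⟨rfl, hi⟩
      · rintro h ⟨i, a⟩ ⟨hv, hi⟩
        simp only at hv
        subst hv; exact h i hi
    rw [this]
  have path := rg_comb d (by simpa using hn) N hcoll hlow hF
    (fun i => ⟨c i, hc.1 i⟩) (fun i => ⟨e i, he.1 i⟩) ((hgr _).2 hc.2) ((hgr _).2 he.2)
  refine Relation.ReflTransGen.lift' (p := CHAdj F)
    (fun (c : ∀ i, α i) => (fun i => (c i).1 : Fin n → Set (Fin d → ℝ))) ?_ _ _ path
  rintro a b ⟨j, hj, hjN⟩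
  by_cases hab : a j = b j
  · have : a = b := by
      funext i
      by_cases h : i = j
      · subst h; exact hab
      · exact hj i h
    subst this; exact Relation.ReflTransGen.refl
  · apply Relation.ReflTransGen.single
    refine ⟨⟨fun i => (a i).2, (hgr a).1 (fun h => hjN (hlow _ h _ (rgGrE_sub a j)))⟩,
      ⟨fun i => (b i).2, (hgr b).1 (fun h => hjN ?_)⟩, j, ?_, ?_, (hgrE a j).1 hjN⟩
    · rw [rgGrE_congr a b j hj]; exact hlow _ h _ (rgGrE_sub b j)
    · intro h; exact hab (Subtype.ext h)
    · intro i hi; exact congrArg Subtype.val (hj i hi)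
end

section
/- Let A_1, …, A_n be finite sets of points in ℝ^d and let x ∈ ℝ^d be a point with x ∈ conv(A_i) for each i ∈ {1,…,n}. If n ≥ d + 2, then the reconfiguration graph RG_CC((A_1, …, A_n), x) is connected. -/
/-- A vertex of the colorful Carathéodory reconfiguration graph
`RG_CC((A_1, …, A_n), x)`: a tuple `(a_1, …, a_n)` with `a_i ∈ A_i` for all `i` and
`x ∈ conv({a_1, …, a_n})`. -/
def CCVertex {d n : ℕ} (A : Fin n → Finset (Fin d → ℝ)) (x : Fin d → ℝ)
    (a : Fin n → (Fin d → ℝ)) : Prop :=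
  (∀ i, a i ∈ A i) ∧ x ∈ convexHull ℝ (Set.range a)

/-- Adjacency in `RG_CC((A_1, …, A_n), x)`: two tuples are adjacent if they differ in
exactly one coordinate `j` and `x` lies in the convex hull of the remaining points. -/
def CCAdj {d n : ℕ} (A : Fin n → Finset (Fin d → ℝ)) (x : Fin d → ℝ)
    (a b : Fin n → (Fin d → ℝ)) : Prop :=
  CCVertex A x a ∧ CCVertex A x b ∧
  ∃ j, a j ≠ b j ∧ (∀ i, i ≠ j → a i = b i) ∧
    x ∈ convexHull ℝ (a '' {i | i ≠ j})

open Matrix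

/-- `l` is a convex representation of `w` by the tuple `a`. -/
def CCRep {d n : ℕ} (a : Fin n → (Fin d → ℝ)) (l : Fin n → ℝ) (w : Fin d → ℝ) : Prop :=
  (∀ i, 0 ≤ l i) ∧ ∑ i, l i = 1 ∧ ∑ i, l i • a i = w

/-- hull of the tuple with index `j` omitted -/
def CCH {d n : ℕ} (a : Fin n → (Fin d → ℝ)) (j : Fin n) : Set (Fin d → ℝ) :=
  {w | ∃ l, CCRep a l w ∧ l j = 0}

def CCF {d n : ℕ} (a : Fin n → (Fin d → ℝ)) : Set (Fin d → ℝ) :=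
  {w | ∃ l, CCRep a l w}

section
variable {d n : ℕ}

lemma CCRep.comb {a : Fin n → (Fin d → ℝ)} {l l' : Fin n → ℝ} {w w' : Fin d → ℝ}
    (h : CCRep a l w) (h' : CCRep a l' w') {s t : ℝ} (hs : 0 ≤ s) (ht : 0 ≤ t) (hst : s + t = 1) :
    CCRep a (fun i => s * l i + t * l' i) (s • w + t • w') := by
  refine ⟨fun i => add_nonneg (mul_nonneg hs (h.1 i)) (mul_nonneg ht (h'.1 i)), ?_, ?_⟩
  · rw [Finset.sum_add_distrib, ← Finset.mul_sum, ← Finset.mul_sum, h.2.1, h'.2.1]; linarith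
  · rw [← h.2.2, ← h'.2.2, Finset.smul_sum, Finset.smul_sum, ← Finset.sum_add_distrib]
    refine Finset.sum_congr rfl fun i _ => ?_
    rw [add_smul, mul_smul, mul_smul]

lemma CCRep.single (a : Fin n → (Fin d → ℝ)) (k : Fin n) : CCRep a (Pi.single k 1) (a k) := by
  refine ⟨fun i => ?_, by simp, ?_⟩
  · by_cases h : i = k
    · subst h; simp
    · simp [h]
  · rw [Finset.sum_eq_single k]
    · simp
    · intro b _ hb; simp [hb]
    · simp

lemma CCH_convex (a : Fin n → (Fin d → ℝ)) (j : Fin n) : Convex ℝ (CCH a j) := by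
  rintro x ⟨l, hl, hj⟩ y ⟨l', hl', hj'⟩ s t hs ht hst
  exact ⟨_, hl.comb hl' hs ht hst, by simp [hj, hj']⟩

lemma CCF_convex (a : Fin n → (Fin d → ℝ)) : Convex ℝ (CCF a) := by
  rintro x ⟨l, hl⟩ y ⟨l', hl'⟩ s t hs ht hst
  exact ⟨_, hl.comb hl' hs ht hst⟩

lemma CCH_mem (a : Fin n → (Fin d → ℝ)) {j k : Fin n} (h : k ≠ j) : a k ∈ CCH a j :=
  ⟨_, CCRep.single a k, by simp [Pi.single_apply, h.symm]⟩

lemma CCH_sub (a : Fin n → (Fin d → ℝ)) (j : Fin n) : CCH a j ⊆ CCF a := by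
  rintro w ⟨l, h, _⟩; exact ⟨l, h⟩

lemma CCH_eq (a : Fin n → (Fin d → ℝ)) (j : Fin n) :
    convexHull ℝ (a '' {i | i ≠ j}) = CCH a j := by
  apply Set.Subset.antisymm
  · apply convexHull_min _ (CCH_convex a j)
    rintro _ ⟨k, hk, rfl⟩
    exact CCH_mem a hk
  · rintro w ⟨l, ⟨h0, h1, h2⟩, hj⟩
    rw [← h2, ← Finset.sum_filter_add_sum_filter_not Finset.univ (fun i => i ≠ j)]
    have e1 : ∑ i with ¬ i ≠ j, l i • a i = 0 := by
      apply Finset.sum_eq_zero; intro i hi; simp at hi; subst hi; simp [hj]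
    have e2 : ∑ i with i ≠ j, l i = 1 := by
      rw [← h1, ← Finset.sum_filter_add_sum_filter_not Finset.univ (fun i => i ≠ j)]
      have : ∑ i with ¬ i ≠ j, l i = 0 := by
        apply Finset.sum_eq_zero; intro i hi; simp at hi; subst hi; simp [hj]
      rw [this, add_zero]
    rw [e1, add_zero]
    apply (convex_convexHull ℝ _).sum_mem (fun i _ => h0 i) e2
    intro i hi
    apply subset_convexHull
    exact ⟨i, by simpa using hi, rfl⟩

lemma CCF_eq (a : Fin n → (Fin d → ℝ)) :
    convexHull ℝ (Set.range a) = CCF a := by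
  apply Set.Subset.antisymm
  · apply convexHull_min _ (CCF_convex a)
    rintro _ ⟨k, rfl⟩
    exact ⟨_, CCRep.single a k⟩
  · rintro w ⟨l, h0, h1, h2⟩
    rw [← h2]
    apply (convex_convexHull ℝ _).sum_mem (fun i _ => h0 i) h1
    intro i hi
    exact subset_convexHull _ _ ⟨i, rfl⟩

/-- squared distance -/
def CCq (y : Fin d → ℝ) : ℝ := y ⬝ᵥ y

lemma CCq_nonneg (y : Fin d → ℝ) : 0 ≤ CCq y := by
  unfold CCq dotProduct
  exact Finset.sum_nonneg fun i _ => mul_self_nonneg _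

lemma CCq_eq_zero {y : Fin d → ℝ} (h : CCq y ≤ 0) : y = 0 :=
  dotProduct_self_eq_zero.1 (le_antisymm h (CCq_nonneg y))

lemma CCq_expand (y u : Fin d → ℝ) (t : ℝ) :
    CCq (y - t • u) = CCq y - 2 * t * (u ⬝ᵥ y) + t ^ 2 * CCq u := by
  unfold CCq
  simp only [sub_dotProduct, dotProduct_sub, smul_dotProduct, dotProduct_smul, smul_eq_mul]
  rw [dotProduct_comm y u]; ring

lemma CC_closer {K : Set (Fin d → ℝ)} (hK : Convex ℝ K) {v z p : Fin d → ℝ} (hz : z ∈ K)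
    (hp : p ∈ K) (h : 0 < (p - z) ⬝ᵥ (v - z)) : ∃ z' ∈ K, CCq (v - z') < CCq (v - z) := by
  set s := (p - z) ⬝ᵥ (v - z) with hs
  have hQ := CCq_nonneg (p - z)
  set Q := CCq (p - z) with hQd
  set t := s / (s + Q) with ht
  have hsQ : 0 < s + Q := by linarith
  have t0 : 0 < t := div_pos h hsQ
  have t1 : t ≤ 1 := by rw [ht, div_le_one hsQ]; linarith
  have tm : t * (s + Q) = s := by rw [ht]; field_simp
  refine ⟨z + t • (p - z), ?_, ?_⟩
  · exact hK.add_smul_sub_mem hz hp ⟨t0.le, t1⟩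
  · have : v - (z + t • (p - z)) = (v - z) - t • (p - z) := by abel
    rw [this, CCq_expand, ← hs, ← hQd]
    have : t ^ 2 * Q = t * (s - t * s) := by
      have : t * Q = s - t * s := by linarith
      rw [← this]; ring
    rw [this]
    nlinarith [mul_pos t0 h, mul_pos (mul_pos t0 t0) h]

lemma CC_var {a : Fin n → (Fin d → ℝ)} {v w z : Fin d → ℝ}
    (h : ∀ i, (a i - w) ⬝ᵥ (v - w) ≤ 0) (hz : z ∈ CCF a) :
    (z - w) ⬝ᵥ (v - w) ≤ 0 := by
  obtain ⟨l, h0, h1, h2⟩ := hz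
  have : z - w = ∑ i, l i • (a i - w) := by
    simp only [smul_sub, Finset.sum_sub_distrib, ← Finset.sum_smul, h1, h2, one_smul]
  rw [this, sum_dotProduct]
  apply Finset.sum_nonpos
  intro i _
  rw [smul_dotProduct, smul_eq_mul]
  exact mul_nonpos_of_nonneg_of_nonpos (h0 i) (h i)

lemma CC_var' {v w z : Fin d → ℝ} (h : (z - w) ⬝ᵥ (v - w) ≤ 0) : CCq (v - w) ≤ CCq (v - z) := by
  have : v - z = (v - w) - (1:ℝ) • (z - w) := by simp
  rw [this, CCq_expand]
  nlinarith [CCq_nonneg (z - w)]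

/-- Existence of a dependency vanishing at `m`. -/
lemma CC_dep (hn : d + 2 ≤ n) (a : Fin n → (Fin d → ℝ)) (w y : Fin d → ℝ) (hy : y ≠ 0)
    (m : Fin n) (h : ∀ i, i ≠ m → (a i - w) ⬝ᵥ y = 0) :
    ∃ e : Fin n → ℝ, e ≠ 0 ∧ e m = 0 ∧ ∑ i, e i = 0 ∧ ∑ i, e i • a i = 0 := by
  let L : (Fin n → ℝ) →ₗ[ℝ] (Fin d → ℝ) × ℝ :=
    (∑ i, (LinearMap.proj i : (Fin n → ℝ) →ₗ[ℝ] ℝ).smulRight (a i - w + y)).prod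
      (LinearMap.proj m)
  have hker : LinearMap.ker L ≠ ⊥ := by
    apply LinearMap.ker_ne_bot_of_finrank_lt
    simp; omega
  obtain ⟨e, he, hne⟩ := (Submodule.ne_bot_iff _).1 hker
  have h1 : ∑ i, e i • (a i - w + y) = 0 := by
    have := congrArg Prod.fst (LinearMap.mem_ker.1 he)
    simpa [L] using this
  have h2 : e m = 0 := by
    have := congrArg Prod.snd (LinearMap.mem_ker.1 he)
    simpa [L] using this
  have h3 : ∑ i, e i = 0 := by
    have := congrArg (fun z => z ⬝ᵥ y) h1
    simp only [sum_dotProduct, smul_dotProduct, add_dotProduct, zero_dotProduct, smul_eq_mul] at this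
    have e1 : ∑ i, e i * ((a i - w) ⬝ᵥ y + y ⬝ᵥ y) = (∑ i, e i) * (y ⬝ᵥ y) := by
      rw [Finset.sum_mul]
      refine Finset.sum_congr rfl fun i _ => ?_
      by_cases him : i = m
      · subst him; simp [h2]
      · rw [h i him, zero_add]
    rw [e1] at this
    rcases mul_eq_zero.1 this with h | h
    · exact h
    · exact absurd (dotProduct_self_eq_zero.1 h) hy
  refine ⟨e, hne, h2, h3, ?_⟩
  have : ∑ i, e i • (a i - w + y) = ∑ i, e i • a i - (∑ i, e i) • w + (∑ i, e i) • y := by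
    simp only [smul_add, smul_sub, Finset.sum_add_distrib, Finset.sum_sub_distrib, Finset.sum_smul]
  rw [this, h3] at h1
  simpa using h1

lemma CCRep.shift {a : Fin n → (Fin d → ℝ)} {l e : Fin n → ℝ} {w : Fin d → ℝ} (h : CCRep a l w)
    (h1 : ∑ i, e i = 0) (h2 : ∑ i, e i • a i = 0) (T : ℝ) (h0 : ∀ i, 0 ≤ l i + T * e i) :
    CCRep a (fun i => l i + T * e i) w := by
  refine ⟨h0, ?_, ?_⟩
  · rw [Finset.sum_add_distrib, ← Finset.mul_sum, h1, h.2.1]; simp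
  · simp only [add_smul, Finset.sum_add_distrib, mul_smul, ← Finset.smul_sum, h2, h.2.2]; simp

lemma CC_neg {e : Fin n → ℝ} (hne : e ≠ 0) (h : ∑ i, e i = 0) : ∃ i, e i < 0 := by
  by_contra! hc
  apply hne
  have := (Finset.sum_eq_zero_iff_of_nonneg (fun i _ => hc i)).1 h
  ext i; exact this i (Finset.mem_univ i)

/-- the exit time of the ray `l + T e` -/
noncomputable def CCT (e : Fin n → ℝ) (h : (Finset.univ.filter fun i => e i < 0).Nonempty)
    (l : Fin n → ℝ) : ℝ :=
  (Finset.univ.filter fun i => e i < 0).inf' h (fun i => l i / (- e i))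

lemma CCT_nonneg {e : Fin n → ℝ} (h : (Finset.univ.filter fun i => e i < 0).Nonempty)
    {l : Fin n → ℝ} (hl : ∀ i, 0 ≤ l i) (i) : 0 ≤ l i + CCT e h l * e i := by
  have hT : 0 ≤ CCT e h l := by
    apply Finset.le_inf'
    intro b hb
    simp at hb
    exact div_nonneg (hl b) (by linarith)
  by_cases hi : e i < 0
  · have : CCT e h l ≤ l i / (- e i) := Finset.inf'_le _ (by simpa using hi)
    rw [le_div_iff₀ (by linarith)] at this
    linarith
  · push Not at hi
    have := mul_nonneg hT hi
    linarith [hl i]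

lemma CCT_zero {e : Fin n → ℝ} (h : (Finset.univ.filter fun i => e i < 0).Nonempty)
    (l : Fin n → ℝ) : ∃ i, e i < 0 ∧ l i + CCT e h l * e i = 0 := by
  obtain ⟨i, hi, hT⟩ := Finset.exists_mem_eq_inf' h (fun i => l i / (- e i))
  simp at hi
  refine ⟨i, hi, ?_⟩
  unfold CCT
  rw [hT]
  have : e i ≠ 0 := hi.ne
  field_simp
  ring

/-- any representation vanishes at a strictly negative index -/
lemma CC_vanish {a : Fin n → (Fin d → ℝ)} {l : Fin n → ℝ} {w y : Fin d → ℝ} (h : CCRep a l w)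
    (hle : ∀ i, l i ≠ 0 → (a i - w) ⬝ᵥ y ≤ 0) {k : Fin n} (hk : (a k - w) ⬝ᵥ y < 0) : l k = 0 := by
  have e0 : ∑ i, l i • (a i - w) = 0 := by
    simp only [smul_sub, Finset.sum_sub_distrib, ← Finset.sum_smul, h.2.1, h.2.2, one_smul, sub_self]
  have e1 := congrArg (fun z => z ⬝ᵥ y) e0
  simp only [sum_dotProduct, smul_dotProduct, zero_dotProduct, smul_eq_mul] at e1
  have := (Finset.sum_eq_zero_iff_of_nonpos (s := Finset.univ)
    (f := fun i => l i * ((a i - w) ⬝ᵥ y)) (fun i _ => ?_)).1 e1 k (Finset.mem_univ k)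
  · rcases mul_eq_zero.1 this with h | h
    · exact h
    · linarith
  · by_cases hi : l i = 0
    · simp [hi]
    · exact mul_nonpos_of_nonneg_of_nonpos (h.1 i) (hle i hi)

def CCN (a : Fin n → (Fin d → ℝ)) (w : Fin d → ℝ) (i j : Fin n) : Prop :=
  ∃ l, CCRep a l w ∧ l i = 0 ∧ l j = 0

lemma CC_neighbor (hn : d + 2 ≤ n) {a : Fin n → (Fin d → ℝ)} {w y : Fin d → ℝ} (hy : y ≠ 0)
    {m : Fin n} (h : ∀ i, i ≠ m → (a i - w) ⬝ᵥ y ≤ 0) (hw : w ∈ CCH a m) :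
    ∃ k, k ≠ m ∧ CCN a w m k := by
  obtain ⟨l, hl, hm⟩ := hw
  by_cases hc : ∃ k, k ≠ m ∧ (a k - w) ⬝ᵥ y < 0
  · obtain ⟨k, hkm, hk⟩ := hc
    refine ⟨k, hkm, l, hl, hm, CC_vanish hl (fun i hi => h i ?_) hk⟩
    rintro rfl; exact hi hm
  · push Not at hc
    obtain ⟨e, hne, em, e1, e2⟩ := CC_dep hn a w y hy m (fun i hi => le_antisymm (h i hi) (hc i hi))
    obtain ⟨i, hi⟩ := CC_neg hne e1
    have hN : (Finset.univ.filter fun i => e i < 0).Nonempty := ⟨i, by simpa using hi⟩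
    obtain ⟨k, hk, hk0⟩ := CCT_zero hN l
    refine ⟨k, ?_, _, hl.shift e1 e2 _ (CCT_nonneg hN hl.1), ?_, hk0⟩
    · rintro rfl; linarith
    · simp [hm, em]

lemma CC_conn (hn : d + 2 ≤ n) {a : Fin n → (Fin d → ℝ)} {w y : Fin d → ℝ} (hy : y ≠ 0)
    (h : ∀ i, (a i - w) ⬝ᵥ y ≤ 0) {m k : Fin n} (hm : w ∈ CCH a m) (hk : w ∈ CCH a k) :
    Relation.ReflTransGen (CCN a w) m k := by
  obtain ⟨l, hl, hlm⟩ := hm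
  obtain ⟨u, hu, huk⟩ := hk
  by_cases hc : ∃ i, (a i - w) ⬝ᵥ y < 0
  · obtain ⟨i, hi⟩ := hc
    exact (Relation.ReflTransGen.single ⟨l, hl, hlm, CC_vanish hl (fun i _ => h i) hi⟩).tail
      ⟨u, hu, CC_vanish hu (fun i _ => h i) hi, huk⟩
  push Not at hc
  obtain ⟨e, em, e1, e2, hN, ek⟩ : ∃ e : Fin n → ℝ, e m = 0 ∧ ∑ i, e i = 0 ∧
      ∑ i, e i • a i = 0 ∧ (Finset.univ.filter fun i => e i < 0).Nonempty ∧ e k ≤ 0 := by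
    obtain ⟨e, hne, em, e1, e2⟩ := CC_dep hn a w y hy m (fun i hi => le_antisymm (h i) (hc i))
    by_cases hek : e k ≤ 0
    · obtain ⟨i, hi⟩ := CC_neg hne e1
      exact ⟨e, em, e1, e2, ⟨i, by simpa using hi⟩, hek⟩
    · push Not at hek
      refine ⟨-e, by simp [em], by simp [e1], by simp [e2], ⟨k, by simpa using hek⟩, ?_⟩
      simp; exact hek.le
  by_contra hcon
  let r : ℝ → Fin n → ℝ := fun t i => (1 - t) * l i + t * u i
  let p : ℝ → Fin n → ℝ := fun t i => r t i + CCT e hN (r t) * e i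
  have hrc : ∀ i, Continuous fun t => r t i := fun i => by fun_prop
  have hTc : Continuous fun t => CCT e hN (r t) := by
    unfold CCT
    apply Continuous.finset_inf'_apply
    intro i _
    exact (hrc i).div_const _
  have hpc : ∀ i, Continuous fun t => p t i := fun i => (hrc i).add (hTc.mul_const _)
  have hr : ∀ t ∈ Set.Icc (0:ℝ) 1, CCRep a (r t) w := by
    intro t ht
    have := hl.comb hu (s := 1 - t) (t := t) (by linarith [ht.2]) ht.1 (by ring)
    rwa [← add_smul, sub_add_cancel, one_smul] at this
  have hp : ∀ t ∈ Set.Icc (0:ℝ) 1, CCRep a (p t) w := fun t ht =>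
    (hr t ht).shift e1 e2 _ (CCT_nonneg hN (hr t ht).1)
  let U : Set (Fin n) := {i | Relation.ReflTransGen (CCN a w) m i}
  have hcl : ∀ S : Set (Fin n), IsClosed (⋃ i ∈ S, {t | p t i = 0}) := fun S =>
    (Set.toFinite S).isClosed_biUnion fun i _ => isClosed_eq (hpc i) continuous_const
  have hpre := isPreconnected_closed_iff.1 (isPreconnected_Icc (a := (0:ℝ)) (b := 1))
    _ _ (hcl U) (hcl Uᶜ) ?_ ⟨0, by simp, ?_⟩ ⟨1, by simp, ?_⟩
  · obtain ⟨t, ht, h1, h2⟩ := hpre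
    simp only [Set.mem_iUnion] at h1 h2
    obtain ⟨i, hi, hi0⟩ := h1
    obtain ⟨j, hj, hj0⟩ := h2
    exact hj (Relation.ReflTransGen.tail hi ⟨p t, hp t ht, hi0, hj0⟩)
  · intro t ht
    obtain ⟨i, _, hi0⟩ := CCT_zero hN (r t)
    by_cases hiU : i ∈ U
    · left; simp only [Set.mem_iUnion]; exact ⟨i, hiU, hi0⟩
    · right; simp only [Set.mem_iUnion]; exact ⟨i, hiU, hi0⟩
  · simp only [Set.mem_iUnion]
    refine ⟨m, Relation.ReflTransGen.refl, ?_⟩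
    simp [p, r, hlm, em]
  · simp only [Set.mem_iUnion]
    refine ⟨k, hcon, ?_⟩
    have h1 := (hp 1 (by simp)).1 k
    have hT : 0 ≤ CCT e hN (r 1) := by
      apply Finset.le_inf'
      intro b hb
      simp at hb
      exact div_nonneg ((hr 1 (by simp)).1 b) (by linarith)
    have h2 : p 1 k = CCT e hN (r 1) * e k := by simp [p, r, huk]
    have := mul_nonpos_of_nonneg_of_nonpos hT ek
    show p 1 k = 0
    linarith

end

section
variable {d n : ℕ}

def CCLow (A : Fin n → Finset (Fin d → ℝ)) (v : Fin d → ℝ) (r : ℝ)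
    (a b : Fin n → (Fin d → ℝ)) : Prop :=
  (∀ i, a i ∈ A i) ∧ (∀ i, b i ∈ A i) ∧ ∃ j, (∀ i, i ≠ j → a i = b i) ∧
    ∃ w ∈ CCH a j, CCq (v - w) < r

def CCLe (A : Fin n → Finset (Fin d → ℝ)) (v : Fin d → ℝ) (r : ℝ)
    (a b : Fin n → (Fin d → ℝ)) : Prop :=
  (∀ i, a i ∈ A i) ∧ (∀ i, b i ∈ A i) ∧ ∃ j, (∀ i, i ≠ j → a i = b i) ∧
    ∃ w ∈ CCH a j, CCq (v - w) ≤ r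

lemma CCRep.congr {a b : Fin n → (Fin d → ℝ)} {l : Fin n → ℝ} {w : Fin d → ℝ}
    (h : CCRep a l w) (hab : ∀ i, l i ≠ 0 → a i = b i) : CCRep b l w := by
  refine ⟨h.1, h.2.1, ?_⟩
  rw [← h.2.2]
  refine Finset.sum_congr rfl fun i _ => ?_
  by_cases hi : l i = 0
  · simp [hi]
  · rw [hab i hi]

lemma CCH_congr {a b : Fin n → (Fin d → ℝ)} {j : Fin n} (h : ∀ i, i ≠ j → a i = b i) :
    CCH a j ⊆ CCH b j := by
  rintro w ⟨l, hl, hj⟩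
  refine ⟨l, hl.congr fun i hi => h i ?_, hj⟩
  rintro rfl; exact hi hj

lemma CCLow_symm (A : Fin n → Finset (Fin d → ℝ)) (v : Fin d → ℝ) (r : ℝ) :
    Std.Symm (CCLow A v r) := by
  constructor
  rintro a b ⟨ha, hb, j, hj, w, hw, hr⟩
  exact ⟨hb, ha, j, fun i hi => (hj i hi).symm, w, CCH_congr hj hw, hr⟩

lemma CC_rsymm {A : Fin n → Finset (Fin d → ℝ)} {v : Fin d → ℝ} {r : ℝ}
    {a b : Fin n → (Fin d → ℝ)} (h : Relation.ReflTransGen (CCLow A v r) a b) :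
    Relation.ReflTransGen (CCLow A v r) b a := by
  induction h with
  | refl => exact .refl
  | tail _ h ih => exact .head ((CCLow_symm A v r).symm _ _ h) ih

lemma CC_upd {A : Fin n → Finset (Fin d → ℝ)} {a : Fin n → (Fin d → ℝ)} (ha : ∀ i, a i ∈ A i)
    {m : Fin n} {g : Fin d → ℝ} (hg : g ∈ A m) : ∀ i, Function.update a m g i ∈ A i := by
  intro i
  by_cases h : i = m
  · subst h; simpa using hg
  · simpa [h] using ha i

lemma CC_low_edge {A : Fin n → Finset (Fin d → ℝ)} {v : Fin d → ℝ} {r : ℝ}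
    {a : Fin n → (Fin d → ℝ)} (ha : ∀ i, a i ∈ A i) {j k : Fin n} (hkj : k ≠ j)
    {g w : Fin d → ℝ} (hg : g ∈ A j) (hw : w ∈ CCH a j) (hr : CCq (v - w) ≤ r)
    (hk : 0 < (a k - w) ⬝ᵥ (v - w)) : CCLow A v r a (Function.update a j g) := by
  refine ⟨ha, CC_upd ha hg, j, fun i hi => by simp [hi], ?_⟩
  obtain ⟨z, hz, hlt⟩ := CC_closer (CCH_convex a j) hw (CCH_mem a hkj) hk
  exact ⟨z, hz, hlt.trans_le hr⟩

lemma CC_swap {A : Fin n → Finset (Fin d → ℝ)} {v : Fin d → ℝ} {r : ℝ}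
    {a : Fin n → (Fin d → ℝ)} (ha : ∀ i, a i ∈ A i) {m k : Fin n} (hkm : k ≠ m)
    {g h w : Fin d → ℝ} (hN : CCN a w m k) (hr : CCq (v - w) ≤ r)
    (hg : g ∈ A m) (hg' : 0 < (g - w) ⬝ᵥ (v - w)) (hh : h ∈ A k)
    (hh' : 0 < (h - w) ⬝ᵥ (v - w)) :
    Relation.ReflTransGen (CCLow A v r) (Function.update a m g) (Function.update a k h) := by
  obtain ⟨l, hl, hm, hk⟩ := hN
  have h1 : CCLow A v r (Function.update a m g) (Function.update (Function.update a m g) k h) := by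
    refine CC_low_edge (CC_upd ha hg) hkm.symm hh ⟨l, hl.congr fun i hi => ?_, hk⟩ hr
      (by simpa using hg')
    have : i ≠ m := by rintro rfl; exact hi hm
    simp [this]
  have h2 : CCLow A v r (Function.update a k h) (Function.update (Function.update a k h) m g) := by
    refine CC_low_edge (CC_upd ha hh) hkm hg ⟨l, hl.congr fun i hi => ?_, hm⟩ hr
      (by simpa using hh')
    have : i ≠ k := by rintro rfl; exact hi hk
    simp [this]
  rw [Function.update_comm hkm] at h2
  exact (Relation.ReflTransGen.single h1).trans (CC_rsymm (.single h2))

lemma CC_good {S : Finset (Fin d → ℝ)} {v w : Fin d → ℝ}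
    (hv : v ∈ convexHull ℝ (S : Set (Fin d → ℝ))) (hvw : 0 < CCq (v - w)) :
    ∃ g ∈ S, 0 < (g - w) ⬝ᵥ (v - w) := by
  by_contra! hc
  have hconv : Convex ℝ {g : Fin d → ℝ | g ⬝ᵥ (v - w) ≤ w ⬝ᵥ (v - w)} :=
    convex_halfSpace_le ⟨fun x y => add_dotProduct _ _ _, fun c x => smul_dotProduct _ _ _⟩ _
  have := convexHull_min (s := (S : Set (Fin d → ℝ))) (fun g hg => by
    have := hc g hg
    rw [sub_dotProduct] at this
    show g ⬝ᵥ (v - w) ≤ w ⬝ᵥ (v - w)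
    linarith) hconv hv
  have h2 : v ⬝ᵥ (v - w) ≤ w ⬝ᵥ (v - w) := this
  unfold CCq at hvw
  rw [sub_dotProduct] at hvw
  linarith

lemma CC_swap_same (hn : d + 2 ≤ n) {A : Fin n → Finset (Fin d → ℝ)} {v : Fin d → ℝ}
    (hx : ∀ i, v ∈ convexHull ℝ ((A i : Set (Fin d → ℝ)))) {r : ℝ}
    {a : Fin n → (Fin d → ℝ)} (ha : ∀ i, a i ∈ A i) {m : Fin n}
    {g h w : Fin d → ℝ} (hw : w ∈ CCH a m) (hr : CCq (v - w) ≤ r) (hpos : 0 < CCq (v - w))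
    (hle : ∀ i, i ≠ m → (a i - w) ⬝ᵥ (v - w) ≤ 0)
    (hg : g ∈ A m) (hg' : 0 < (g - w) ⬝ᵥ (v - w)) (hh : h ∈ A m)
    (hh' : 0 < (h - w) ⬝ᵥ (v - w)) :
    Relation.ReflTransGen (CCLow A v r) (Function.update a m g) (Function.update a m h) := by
  have hy : v - w ≠ 0 := by
    intro h; rw [h] at hpos; simp [CCq] at hpos
  obtain ⟨k, hkm, hN⟩ := CC_neighbor hn hy hle hw
  obtain ⟨p, hp, hp'⟩ := CC_good (hx k) hpos
  exact (CC_swap ha hkm hN hr hg hg' hp hp').trans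
    (CC_rsymm (CC_swap ha hkm hN hr hh hh' hp hp'))

lemma CC_G (hn : d + 2 ≤ n) {A : Fin n → Finset (Fin d → ℝ)} {v : Fin d → ℝ}
    (hx : ∀ i, v ∈ convexHull ℝ ((A i : Set (Fin d → ℝ)))) {r : ℝ} (hr0 : 0 < r)
    {a : Fin n → (Fin d → ℝ)} (ha : ∀ i, a i ∈ A i) (hmin : ∀ z ∈ CCF a, r ≤ CCq (v - z))
    {m k : Fin n} {g h w w' : Fin d → ℝ}
    (hw : w ∈ CCH a m) (hr : CCq (v - w) ≤ r)
    (hg : g ∈ A m) (hg' : 0 < (g - w) ⬝ᵥ (v - w))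
    (hw' : w' ∈ CCH a k) (hr' : CCq (v - w') ≤ r) (hh : h ∈ A k)
    (hh' : 0 < (h - w') ⬝ᵥ (v - w')) :
    Relation.ReflTransGen (CCLow A v r) (Function.update a m g) (Function.update a k h) := by
  have key : ∀ w ∈ CCF a, CCq (v - w) ≤ r → ∀ z ∈ CCF a, (z - w) ⬝ᵥ (v - w) ≤ 0 := by
    intro w hw hr z hz
    by_contra! hc
    obtain ⟨z', hz', hlt⟩ := CC_closer (CCF_convex a) hw hz hc
    linarith [hmin z' hz']
  have hww : w' = w := by
    have h1 := key w (CCH_sub a m hw) hr w' (CCH_sub a k hw')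
    have h2 := key w' (CCH_sub a k hw') hr' w (CCH_sub a m hw)
    apply sub_eq_zero.1
    apply CCq_eq_zero
    unfold CCq
    simp only [sub_dotProduct, dotProduct_sub] at h1 h2 ⊢
    linarith
  subst hww
  have hpos : 0 < CCq (v - w') := hr0.trans_le (hmin _ (CCH_sub a m hw))
  have hy : v - w' ≠ 0 := by
    intro h; rw [h] at hpos; simp [CCq] at hpos
  have hle : ∀ i, (a i - w') ⬝ᵥ (v - w') ≤ 0 := fun i =>
    key w' (CCH_sub a m hw) hr _ ⟨_, CCRep.single a i⟩
  have hconn := CC_conn hn hy hle hw hw'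
  clear hw'
  induction hconn generalizing h with
  | refl => exact CC_swap_same hn hx ha hw hr hpos (fun i _ => hle i) hg hg' hh hh'
  | @tail b c _ hbc ih =>
    by_cases hcb : c = b
    · subst hcb; exact ih hh hh'
    · obtain ⟨p, hp, hp'⟩ := CC_good (hx b) hpos
      exact (ih hp hp').trans (CC_swap ha hcb hbc hr hp hp' hh hh')

lemma CC_good_end {a : Fin n → (Fin d → ℝ)} {v w : Fin d → ℝ} {r : ℝ} {j : Fin n}
    (hw : w ∈ CCH a j) (hr : CCq (v - w) ≤ r) (hno : ∀ z ∈ CCH a j, r ≤ CCq (v - z))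
    (hlt : ∃ z ∈ CCF a, CCq (v - z) < r) :
    (∀ i, i ≠ j → (a i - w) ⬝ᵥ (v - w) ≤ 0) ∧ 0 < (a j - w) ⬝ᵥ (v - w) := by
  have h1 : ∀ i, i ≠ j → (a i - w) ⬝ᵥ (v - w) ≤ 0 := by
    intro i hi
    by_contra! hc
    obtain ⟨z', hz', hlt⟩ := CC_closer (CCH_convex a j) hw (CCH_mem a hi) hc
    linarith [hno z' hz']
  refine ⟨h1, ?_⟩
  by_contra! hc
  obtain ⟨z, hz, hlt⟩ := hlt
  have := CC_var' (CC_var (a := a) (v := v) (w := w) (fun i => by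
    by_cases hi : i = j
    · subst hi; exact hc
    · exact h1 i hi) hz)
  linarith [hno w hw]

lemma CC_step (hn : d + 2 ≤ n) {A : Fin n → Finset (Fin d → ℝ)} {v : Fin d → ℝ}
    (hx : ∀ i, v ∈ convexHull ℝ ((A i : Set (Fin d → ℝ)))) {r : ℝ} (hr0 : 0 < r)
    {x0 b : Fin n → (Fin d → ℝ)} (h0 : ∃ z ∈ CCF x0, CCq (v - z) < r)
    (h : Relation.ReflTransGen (CCLe A v r) x0 b) :
    ((∃ z ∈ CCF b, CCq (v - z) < r) → Relation.ReflTransGen (CCLow A v r) x0 b) ∧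
    ((∀ z ∈ CCF b, r ≤ CCq (v - z)) → ∀ (m : Fin n) (g w : Fin d → ℝ), w ∈ CCH b m →
      CCq (v - w) ≤ r → g ∈ A m → 0 < (g - w) ⬝ᵥ (v - w) →
      Relation.ReflTransGen (CCLow A v r) x0 (Function.update b m g)) := by
  induction h with
  | refl =>
    refine ⟨fun _ => .refl, fun h => ?_⟩
    obtain ⟨z, hz, hlt⟩ := h0
    linarith [h z hz]
  | @tail a b _ hab ih =>
    obtain ⟨ha, hb, j, hj, w, hw, hr⟩ := hab
    have hwb : w ∈ CCH b j := CCH_congr hj hw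
    by_cases hlow : ∃ z ∈ CCH a j, CCq (v - z) < r
    · obtain ⟨z, hz, hlt⟩ := hlow
      have hzb := CCH_congr hj hz
      refine ⟨fun _ => (ih.1 ⟨z, CCH_sub a j hz, hlt⟩).tail ⟨ha, hb, j, hj, z, hz, hlt⟩,
        fun h => ?_⟩
      linarith [h z (CCH_sub b j hzb)]
    push Not at hlow
    have hlowb : ∀ z ∈ CCH b j, r ≤ CCq (v - z) := fun z hz =>
      hlow z (CCH_congr (fun i hi => (hj i hi).symm) hz)
    have hpos : 0 < CCq (v - w) := hr0.trans_le (hlow w hw)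
    have hab' : ∀ g, Function.update a j g = Function.update b j g := by
      intro g; ext1 i
      by_cases hi : i = j
      · subst hi; simp
      · simp [hi, hj i hi]
    by_cases hca : ∃ z ∈ CCF a, CCq (v - z) < r
    · obtain ⟨hla, hga⟩ := CC_good_end hw hr hlow hca
      have hxa := ih.1 hca
      constructor
      · intro hcb
        obtain ⟨hlb, hgb⟩ := CC_good_end hwb hr hlowb hcb
        have := CC_swap_same hn hx ha hw hr hpos hla (ha j) hga (hb j) hgb
        rw [hab' (b j)] at this
        simp only [Function.update_eq_self] at this
        exact hxa.trans this
      · intro hmin m g w' hw' hr' hg hg'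
        have := CC_G hn hx hr0 hb hmin hwb hr (ha j) hga hw' hr' hg hg'
        rw [← hab', Function.update_eq_self] at this
        exact hxa.trans this
    · push Not at hca
      have hxa := ih.2 hca
      constructor
      · intro hcb
        obtain ⟨hlb, hgb⟩ := CC_good_end hwb hr hlowb hcb
        have := hxa j (b j) w hw hr (hb j) hgb
        rwa [hab', Function.update_eq_self] at this
      · intro hmin m g w' hw' hr' hg hg'
        obtain ⟨p, hp, hp'⟩ := CC_good (hx j) hpos
        have h1 := hxa j p w hw hr hp hp'
        rw [hab'] at h1
        exact h1.trans (CC_G hn hx hr0 hb hmin hwb hr hp hp' hw' hr' hg hg')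

lemma CC_attain (hn : d + 2 ≤ n) (v : Fin d → ℝ) (a : Fin n → (Fin d → ℝ)) (j : Fin n) :
    ∃ w ∈ CCH a j, ∀ z ∈ CCH a j, CCq (v - w) ≤ CCq (v - z) := by
  have hc : IsCompact (CCH a j) := by
    rw [← CCH_eq]
    exact Set.Finite.isCompact_convexHull (𝕜 := ℝ) (Set.toFinite _)
  have hne : (CCH a j).Nonempty := by
    haveI : Nontrivial (Fin n) := Fin.nontrivial_iff_two_le.2 (by omega)
    obtain ⟨k, hk⟩ := exists_ne j
    exact ⟨_, CCH_mem a hk⟩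
  have hcont : Continuous fun z : Fin d → ℝ => CCq (v - z) := by
    unfold CCq dotProduct; fun_prop
  obtain ⟨w, hw, hmin⟩ := hc.exists_isMinOn hne hcont.continuousOn
  exact ⟨w, hw, fun z hz => hmin hz⟩

lemma CC_all {A : Fin n → Finset (Fin d → ℝ)} (R : (Fin n → Fin d → ℝ) → (Fin n → Fin d → ℝ) → Prop)
    (hR : ∀ a : Fin n → Fin d → ℝ, (∀ i, a i ∈ A i) → ∀ j, ∀ g ∈ A j, R a (Function.update a j g))
    {a b : Fin n → Fin d → ℝ} (ha : ∀ i, a i ∈ A i) (hb : ∀ i, b i ∈ A i) :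
    Relation.ReflTransGen R a b := by
  have : ∀ S : Finset (Fin n), Relation.ReflTransGen R a (S.piecewise b a) := by
    intro S
    induction S using Finset.induction_on with
    | empty => simpa using Relation.ReflTransGen.refl
    | insert j S _ ih =>
      rw [Finset.piecewise_insert]
      refine ih.tail (hR _ (fun i => ?_) j _ (hb j))
      by_cases h : i ∈ S
      · simpa [h] using hb i
      · simpa [h] using ha i
  simpa using this Finset.univ

end

theorem stmt_4 {d n : ℕ} (A : Fin n → Finset (Fin d → ℝ)) (x : Fin d → ℝ)
    (hx : ∀ i, x ∈ convexHull ℝ ((A i : Set (Fin d → ℝ))))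
    (hn : d + 2 ≤ n)
    (a b : Fin n → (Fin d → ℝ))
    (ha : CCVertex A x a) (hb : CCVertex A x b) :
    Relation.ReflTransGen (CCAdj A x) a b := by
  classical
  -- edge costs
  choose W hW hWmin using CC_attain hn x
  let cost : (Fin n → Fin d → ℝ) × Fin n → ℝ := fun p => CCq (x - W p.1 p.2)
  let V : Finset ℝ := insert 0 ((Fintype.piFinset A ×ˢ Finset.univ).image cost)
  have hmemV : ∀ c : Fin n → Fin d → ℝ, (∀ i, c i ∈ A i) → ∀ j, cost (c, j) ∈ V := by
    intro c hc j
    apply Finset.mem_insert_of_mem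
    apply Finset.mem_image_of_mem
    simpa [Fintype.mem_piFinset] using hc
  have hVne : V.Nonempty := ⟨0, Finset.mem_insert_self _ _⟩
  have hVnn : ∀ r ∈ V, 0 ≤ r := by
    intro r hr
    rcases Finset.mem_insert.1 hr with rfl | hr
    · exact le_rfl
    · obtain ⟨p, _, rfl⟩ := Finset.mem_image.1 hr
      exact CCq_nonneg _
  let S : Finset ℝ := V.filter fun r => Relation.ReflTransGen (CCLe A x r) a b
  have hS : S.Nonempty := by
    refine ⟨V.max' hVne, Finset.mem_filter.2 ⟨Finset.max'_mem _ _, ?_⟩⟩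
    refine CC_all _ (fun c hc j g hg => ?_) ha.1 hb.1
    exact ⟨hc, CC_upd hc hg, j, fun i hi => by simp [hi], W c j, hW c j,
      Finset.le_max' V _ (hmemV c hc j)⟩
  have hmem := Finset.min'_mem S hS
  set r := S.min' hS with hr
  obtain ⟨hrV, hconn⟩ := Finset.mem_filter.1 hmem
  have hxa : x ∈ CCF a := by rw [← CCF_eq]; exact ha.2
  have hxb : x ∈ CCF b := by rw [← CCF_eq]; exact hb.2
  have hq0 : CCq (x - x) = 0 := by simp [CCq]
  have hr0 : r = 0 := by
    by_contra hne
    have hpos : 0 < r := lt_of_le_of_ne (hVnn r hrV) (Ne.symm hne)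
    have hlow := (CC_step hn hx hpos ⟨x, hxa, by rwa [hq0]⟩ hconn).1 ⟨x, hxb, by rwa [hq0]⟩
    let V' := V.filter fun s => s < r
    have hV' : V'.Nonempty := ⟨0, Finset.mem_filter.2 ⟨Finset.mem_insert_self _ _, hpos⟩⟩
    have hm' := Finset.max'_mem V' hV'
    obtain ⟨h1, h2⟩ := Finset.mem_filter.1 hm'
    have : V'.max' hV' ∈ S := by
      refine Finset.mem_filter.2 ⟨h1, Relation.ReflTransGen.mono ?_ _ _ hlow⟩
      rintro c c' ⟨hc, hc', j, hj, w, hw, hwr⟩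
      refine ⟨hc, hc', j, hj, W c j, hW c j, ?_⟩
      apply Finset.le_max' V'
      exact Finset.mem_filter.2 ⟨hmemV c hc j, (hWmin c j w hw).trans_lt hwr⟩
    have := Finset.min'_le S _ this
    linarith
  rw [hr0] at hconn
  clear_value r
  clear hb hxb hmem hr hrV hS S
  induction hconn with
  | refl => exact .refl
  | @tail c e _ hce ih =>
    obtain ⟨hc, he, j, hj, w, hw, hwr⟩ := hce
    have hxw : x = w := sub_eq_zero.1 (CCq_eq_zero hwr)
    subst hxw
    by_cases hjj : c j = e j
    · have : c = e := by
        ext1 i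
        by_cases hi : i = j
        · subst hi; exact hjj
        · exact hj i hi
      exact this ▸ ih
    · refine ih.tail ⟨⟨hc, ?_⟩, ⟨he, ?_⟩, j, hjj, hj, ?_⟩
      · rw [CCF_eq]; exact CCH_sub c j hw
      · rw [CCF_eq]; exact CCH_sub e j (CCH_congr hj hw)
      · rw [CCH_eq]; exact hw
end

section
/- Let M and N be matroids on the same finite ground set V and let k ≥ 1 be an integer. If r(M|X) + r(N|(V − X)) ≥ k + 1 for every X ⊆ V such that V − X is a flat of N of rank at most k − 1, then the reconfiguration graph RG(M, N; k) is connected. -/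
open Finset
open scoped Classical

/-- The rank of the restriction of the matroid `M` to the finite set `X`:
the maximum size of a subset of `X` independent in `M`. -/
noncomputable def mrank {α : Type*} [DecidableEq α] (M : Matroid α) (X : Finset α) : ℕ :=
  X.powerset.sup fun S => if M.Indep ↑S then S.card else 0

/-- `F` is a flat of the matroid `N` (with ground set the whole finite type):
adding any element outside `F` increases the rank. -/
def IsFlatF {α : Type*} [Fintype α] [DecidableEq α] (N : Matroid α) (F : Finset α) : Prop :=
  ∀ x ∉ F, mrank N F < mrank N (insert x F)

/-- A vertex of the reconfiguration graph `RG(M, N; k)`: a `k`-element set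
independent in both matroids. -/
def MIVertex {α : Type*} (M N : Matroid α) (k : ℕ) (S : Finset α) : Prop :=
  S.card = k ∧ M.Indep ↑S ∧ N.Indep ↑S

/-- Adjacency in `RG(M, N; k)`: two common independent `k`-sets `S, T` are adjacent if
`S ∪ T` is independent in `M` and has cardinality `k + 1`. -/
def MIAdj {α : Type*} [DecidableEq α] (M N : Matroid α) (k : ℕ) (S T : Finset α) : Prop :=
  MIVertex M N k S ∧ MIVertex M N k T ∧
    M.Indep ↑(S ∪ T) ∧ (S ∪ T).card = k + 1

structure IsRk {β : Type*} [DecidableEq β] (r : Finset β → ℤ) : Prop where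
  empty : r ∅ = 0
  sub : ∀ A B D E : Finset β, D ⊆ A → D ⊆ B → E ⊆ A ∪ B → r E + r D ≤ r A + r B
  unit : ∀ x A, r (insert x A) ≤ r A + 1

namespace IsRk
variable {β : Type*} [DecidableEq β] {r : Finset β → ℤ}

lemma mono (h : IsRk r) {A B : Finset β} (hAB : A ⊆ B) : r A ≤ r B := by
  have := h.sub B B B A subset_rfl subset_rfl (by simpa using hAB)
  linarith

lemma union_le (h : IsRk r) (A B : Finset β) : r (A ∪ B) ≤ r A + B.card := by
  induction B using Finset.induction_on with
  | empty => simp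
  | insert x B hx ih =>
    have := h.unit x (A ∪ B)
    rw [Finset.union_insert, Finset.card_insert_of_notMem hx]
    push_cast
    linarith

lemma le_card (h : IsRk r) (B : Finset β) : r B ≤ B.card := by
  have := h.union_le ∅ B
  rw [h.empty] at this
  simpa using this

lemma contract (h : IsRk r) (C : Finset β) : IsRk (fun X => r (X ∪ C) - r C) where
  empty := by simp
  sub A B D E h1 h2 h3 := by
    have := h.sub (A ∪ C) (B ∪ C) (D ∪ C) (E ∪ C) (by grind) (by grind) (by grind)
    linarith
  unit x A := by
    have := h.unit x (A ∪ C)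
    simp only [Finset.insert_union]
    linarith

end IsRk

section pairs
variable {ι : Type*} [DecidableEq ι]

def trv (J : Finset ι) (f : ι → Bool) : Finset (ι × Bool) := J.image (fun i => (i, f i))

def prs (J : Finset ι) : Finset (ι × Bool) := J ×ˢ Finset.univ

lemma mem_trv {J : Finset ι} {f : ι → Bool} {x : ι × Bool} :
    x ∈ trv J f ↔ x.1 ∈ J ∧ f x.1 = x.2 := by
  rcases x with ⟨i, b⟩
  simp only [trv, Finset.mem_image, Prod.mk.injEq]
  constructor
  · rintro ⟨a, ha, rfl, rfl⟩; exact ⟨ha, rfl⟩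
  · rintro ⟨h1, h2⟩; exact ⟨i, h1, rfl, h2⟩

lemma mem_prs {J : Finset ι} {x : ι × Bool} : x ∈ prs J ↔ x.1 ∈ J := by
  simp [prs]

lemma card_trv (J : Finset ι) (f : ι → Bool) : (trv J f).card = J.card := by
  apply Finset.card_image_of_injective
  intro a b h
  exact (Prod.mk.inj h).1

lemma trv_sub_prs (J : Finset ι) (f : ι → Bool) : trv J f ⊆ prs J := by
  intro x hx; rw [mem_trv] at hx; rw [mem_prs]; exact hx.1

lemma rado (n : ℕ) : ∀ (r : Finset (ι × Bool) → ℤ), IsRk r → ∀ J : Finset ι, J.card = n →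
    (∀ I ⊆ J, (I.card : ℤ) ≤ r (prs I)) → ∃ f, r (trv J f) = J.card := by
  induction n with
  | zero =>
    intro r hr J hJ _
    rw [Finset.card_eq_zero] at hJ
    subst hJ
    exact ⟨fun _ => true, by simp [trv, hr.empty]⟩
  | succ n ih =>
    intro r hr J hJ hH
    obtain ⟨m, hm⟩ : J.Nonempty := by rw [← Finset.card_pos]; omega
    have hc : (J.erase m).card = n := by rw [Finset.card_erase_of_mem hm]; omega
    have key : ∃ a : Bool, ∀ I ⊆ J.erase m, (I.card : ℤ) + 1 ≤ r (prs I ∪ {(m, a)}) := by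
      by_contra hcon
      push Not at hcon
      obtain ⟨I1, h1, hh1⟩ := hcon true
      obtain ⟨I2, h2, hh2⟩ := hcon false
      have hs := hr.sub (prs I1 ∪ {(m, true)}) (prs I2 ∪ {(m, false)}) (prs (I1 ∩ I2))
        (prs (insert m (I1 ∪ I2))) (by intro x; simp [mem_prs]; tauto)
        (by intro x; simp [mem_prs]; tauto)
        (by rintro ⟨i, b⟩; simp [mem_prs]; cases b <;> simp)
      have e1 := hH (insert m (I1 ∪ I2)) (by grind)
      have e2 := hH (I1 ∩ I2) (by grind)
      rw [Finset.card_insert_of_notMem (by grind)] at e1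
      have := Finset.card_union_add_card_inter I1 I2
      push_cast at e1
      omega
    obtain ⟨a, ha⟩ := key
    have ha0 : r {(m, a)} = 1 := by
      have e1 := ha ∅ (by simp)
      have e2 := hr.le_card {(m, a)}
      simp [prs] at e1 e2
      omega
    obtain ⟨f, hf⟩ := ih _ (hr.contract {(m, a)}) (J.erase m) hc (by
      intro I hI
      have := ha I hI
      simp only [ha0]
      omega)
    refine ⟨Function.update f m a, ?_⟩
    have : trv J (Function.update f m a) = trv (J.erase m) f ∪ {(m, a)} := by
      ext ⟨i, b⟩
      by_cases hi : i = m
      · subst hi; simp [mem_trv, hm, eq_comm]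
      · simp [mem_trv, hi]
    rw [this]
    simp only [ha0] at hf
    omega

def Stp (r : Finset (ι × Bool) → ℤ) (J : Finset ι) (f g : ι → Bool) : Prop :=
  trv J f = trv J g ∨
    (r (trv J f ∪ trv J g) = (trv J f ∪ trv J g).card ∧ (trv J f ∪ trv J g).card ≤ J.card + 1)

lemma Stp.symm {r : Finset (ι × Bool) → ℤ} {J : Finset ι} {f g : ι → Bool} (h : Stp r J f g) :
    Stp r J g f := by
  rcases h with h | h
  · exact Or.inl h.symm
  · right; rwa [Finset.union_comm]

abbrev Cnn (r : Finset (ι × Bool) → ℤ) (J : Finset ι) := Relation.ReflTransGen (Stp r J)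

lemma Cnn.symmetric {r : Finset (ι × Bool) → ℤ} {J : Finset ι} {f g : ι → Bool} (h : Cnn r J f g) :
    Cnn r J g f := by
  have : Std.Symm (Stp r J) := ⟨fun _ _ => Stp.symm⟩
  exact Relation.ReflTransGen.stdSymm.symm _ _ h

lemma Cnn.of_eq {r : Finset (ι × Bool) → ℤ} {J : Finset ι} {f g : ι → Bool}
    (h : ∀ i ∈ J, f i = g i) : Cnn r J f g := by
  apply Relation.ReflTransGen.single
  left
  ext x
  simp only [mem_trv]
  grind

lemma trv_piecewise {R J : Finset ι} (hR : R ⊆ J) (p f : ι → Bool) :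
    trv J (R.piecewise p f) = trv R p ∪ trv (J \ R) f := by
  ext ⟨i, b⟩
  by_cases hi : i ∈ R
  · simp [mem_trv, hi, hR hi]
  · simp [mem_trv, hi]

lemma lift_conn {r ρ : Finset (ι × Bool) → ℤ} (hr : IsRk r) {R J : Finset ι} (hR : R ⊆ J)
    (f : ι → Bool)
    (hρ : ∀ Z ⊆ prs R, ρ Z + ((J \ R).card : ℤ) ≤ r (Z ∪ trv (J \ R) f))
    {p q : ι → Bool} (h : Cnn ρ R p q) :
    Cnn r J (R.piecewise p f) (R.piecewise q f) := by
  refine Relation.ReflTransGen.lift (p := Stp r J) (fun p => R.piecewise p f) ?_ _ _ h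
  intro p q hpq
  simp only [Stp, trv_piecewise hR]
  rcases hpq with h | ⟨h1, h2⟩
  · left; rw [h]
  · right
    have e : trv R p ∪ trv (J \ R) f ∪ (trv R q ∪ trv (J \ R) f)
      = (trv R p ∪ trv R q) ∪ trv (J \ R) f := by grind
    rw [e]
    have a1 := hρ (trv R p ∪ trv R q) (Finset.union_subset (trv_sub_prs _ _) (trv_sub_prs _ _))
    have a2 := hr.le_card ((trv R p ∪ trv R q) ∪ trv (J \ R) f)
    have a3 := Finset.card_union_le (trv R p ∪ trv R q) (trv (J \ R) f)
    rw [card_trv] at a3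
    have a4 := Finset.card_sdiff_add_card_eq_card hR
    omega

theorem dragon (n : ℕ) : ∀ (r : Finset (ι × Bool) → ℤ), IsRk r → ∀ J : Finset ι, J.card = n →
    (∀ I ⊆ J, I.Nonempty → (I.card : ℤ) + 1 ≤ r (prs I)) → ∀ f g, r (trv J f) = J.card →
    r (trv J g) = J.card → Cnn r J f g := by
  induction n using Nat.strong_induction_on with
  | _ n ih =>
  intro r hr J hJ hH
  rcases J.eq_empty_or_nonempty with rfl | ⟨m, hm⟩
  · intro f g _ _
    exact Cnn.of_eq (by simp)
  have hJ1 : (J.erase m).card + 1 = n := by rw [Finset.card_erase_add_one hm]; exact hJ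
  have face : ∀ a : Bool, ∀ f g, f m = a → g m = a → r (trv J f) = J.card →
      r (trv J g) = J.card → Cnn r J f g := by
    intro a f g hfm hgm hf hg
    have single : r {(m, a)} = 1 := by
      have e1 := hr.le_card {(m, a)}
      have e2 := hr.union_le {(m, a)} (trv (J.erase m) f)
      have e3 := hr.mono (A := trv J f) (B := {(m, a)} ∪ trv (J.erase m) f) (by
        rintro ⟨i, b⟩; simp [mem_trv]; grind)
      rw [card_trv] at e2
      simp at e1
      omega
    -- maximal K
    obtain ⟨K, hK, hKmax⟩ := ((J.erase m).powerset.filter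
      (fun K => r (prs K ∪ {(m, a)}) = K.card + 1)).exists_max_image Finset.card
      ⟨∅, by simp [prs, single]⟩
    rw [Finset.mem_filter, Finset.mem_powerset] at hK
    obtain ⟨hKJ, hKr⟩ := hK
    have hmK : m ∉ K := fun h => by simpa using hKJ h
    obtain ⟨R, hRdef⟩ : ∃ R, R = J.erase m \ K := ⟨_, rfl⟩
    have hRJe : R ⊆ J.erase m := by rw [hRdef]; exact Finset.sdiff_subset
    have hmR : m ∉ R := fun h => by simpa using hRJe h
    have hRJ : R ⊆ J := hRJe.trans (Finset.erase_subset _ _)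
    have hKJJ : K ⊆ J := hKJ.trans (Finset.erase_subset _ _)
    have hdis : Disjoint R K := by rw [hRdef]; exact Finset.sdiff_disjoint
    have hcard : R.card + K.card + 1 = J.card := by
      rw [hRdef, Finset.card_sdiff_add_card_eq_card hKJ]; omega
    have hmem : ∀ i, i ∈ J ↔ i ∈ R ∨ i ∈ K ∨ i = m := by
      intro i; rw [hRdef]; simp; grind
    obtain ⟨C, hC⟩ : ∃ C, C = prs K ∪ {(m, a)} := ⟨_, rfl⟩
    rw [← hC] at hKr
    obtain ⟨Cb, hCb⟩ : ∃ Cb, Cb = prs (insert m K) := ⟨_, rfl⟩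
    have memC : ∀ i b, (i, b) ∈ C ↔ i ∈ K ∨ (i = m ∧ b = a) := by
      intro i b; simp [hC, mem_prs]; tauto
    have memCb : ∀ i b, (i, b) ∈ Cb ↔ i ∈ K ∨ i = m := by
      intro i b; simp [hCb, mem_prs]; tauto
    have hCbins : Cb = insert (m, !a) C := by
      ext ⟨i, b⟩
      simp only [Finset.mem_insert, memC, memCb, Prod.mk.injEq]
      cases a <;> cases b <;> simp <;> tauto
    have hCbr : r Cb = K.card + 2 := by
      have e1 := hH (insert m K) (by grind) (by simp)
      rw [← hCb, Finset.card_insert_of_notMem hmK] at e1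
      have e2 := hr.unit (m, !a) C
      rw [← hCbins] at e2
      push_cast at e1
      omega
    -- dragon on R in the contraction
    have dR : ∀ I ⊆ R, I.Nonempty → (I.card : ℤ) + 1 ≤ r (prs I ∪ C) - r C := by
      intro I hI hIn
      have hIK : Disjoint I K := Finset.disjoint_of_subset_left hI hdis
      have hcu := Finset.card_union_of_disjoint hIK
      have e1 := hH (I ∪ K) (by grind) (hIn.mono Finset.subset_union_left)
      have e2 := hr.mono (A := prs (I ∪ K)) (B := prs I ∪ C) (by
        rintro ⟨i, b⟩; simp only [Finset.mem_union, memC, mem_prs]; tauto)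
      have e3 : r (prs I ∪ C) ≠ (I ∪ K).card + 1 := by
        intro hcon
        have := hKmax (I ∪ K) (by
          rw [Finset.mem_filter, Finset.mem_powerset]
          refine ⟨by grind, ?_⟩
          rw [← hcon]
          congr 1
          ext ⟨i, b⟩; simp only [Finset.mem_union, memC, mem_prs, Finset.mem_singleton, Prod.mk.injEq]; tauto)
        have := hIn.card_pos
        omega
      omega
    -- rado
    obtain ⟨h, hh⟩ := rado R.card _ (hr.contract Cb) R rfl (by
      intro I hI
      have e1 := hH (I ∪ insert m K) (by grind) (by simp)
      have hIK : Disjoint I (insert m K) := by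
        rw [Finset.disjoint_left]; intro x hx; have := Finset.disjoint_left.1 hdis (hI hx); grind
      rw [Finset.card_union_of_disjoint hIK, Finset.card_insert_of_notMem hmK] at e1
      have e2 : prs (I ∪ insert m K) = prs I ∪ Cb := by
        ext ⟨i, b⟩; simp only [Finset.mem_union, memCb, mem_prs, Finset.mem_insert]; tauto
      rw [e2] at e1
      push_cast at e1
      try simp only
      omega)
    try simp only at hh
    have indC : r (trv R h ∪ C) = R.card + K.card + 1 := by
      have e1 := hr.unit (m, !a) (trv R h ∪ C)
      rw [← Finset.union_insert, ← hCbins] at e1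
      have e2 := hr.union_le C (trv R h)
      rw [card_trv, Finset.union_comm] at e2
      omega
    obtain ⟨q, hq⟩ : ∃ q : (ι → Bool) → ι → Bool,
      q = fun φ => Function.update (R.piecewise h φ) m (!a) := ⟨_, rfl⟩
    have half : ∀ f, f m = a → r (trv J f) = J.card → Cnn r J f (q f) := by
      intro f hfm hf
      have memD : ∀ i b, (i, b) ∈ trv (J \ R) f ↔ (i ∈ K ∧ f i = b) ∨ (i = m ∧ b = a) := by
        intro i b
        have := fun h : i ∈ R => Finset.disjoint_left.1 hdis h
        simp only [mem_trv, Finset.mem_sdiff, hmem]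
        grind
      have hDc : (J \ R).card = K.card + 1 := by
        have := Finset.card_sdiff_add_card_eq_card hRJ
        omega
      have hDr : r (trv (J \ R) f) = K.card + 1 := by
        have e1 := hr.union_le (trv (J \ R) f) (trv R f)
        have e2 := hr.le_card (trv (J \ R) f)
        have e3 := hr.mono (A := trv J f) (B := trv (J \ R) f ∪ trv R f) (by
          rintro ⟨i, b⟩; simp only [mem_trv, Finset.mem_union, Finset.mem_sdiff]; tauto)
        rw [card_trv] at e1 e2
        omega
      have hDC : trv (J \ R) f ⊆ C := by
        rintro ⟨i, b⟩; rw [memD, memC]; tauto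
      have c1 : Cnn r J f (R.piecewise h f) := by
        have l := lift_conn hr hRJ f (ρ := fun X => r (X ∪ C) - r C) (p := f) (q := h) (by
          intro Z _
          have := hr.sub (Z ∪ trv (J \ R) f) C (trv (J \ R) f) (Z ∪ C) Finset.subset_union_right hDC
            (by grind)
          try simp only
          omega) (ih R.card (by omega) _ (hr.contract C) R rfl dR f h (by
            have e2 := hr.union_le C (trv R f)
            rw [card_trv, Finset.union_comm] at e2
            have e3 := hr.mono (A := trv J f) (B := trv R f ∪ C) (by
              rintro ⟨i, b⟩; simp only [mem_trv, Finset.mem_union, memC, hmem]; grind)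
            try simp only
            omega) (by omega))
        exact (Cnn.of_eq (by intro i _; by_cases hi : i ∈ R <;> simp [hi])).trans l
      refine c1.trans (Relation.ReflTransGen.single ?_)
      right
      have e : trv J (R.piecewise h f) ∪ trv J (q f) = trv R h ∪ insert (m, !a) (trv (J \ R) f) := by
        ext ⟨i, b⟩
        rw [trv_piecewise hRJ]
        have := fun h : i ∈ R => Finset.disjoint_left.1 hdis h
        by_cases him : i = m
        · subst him
          simp [mem_trv, hq, hm, hmR, hfm, eq_comm]; tauto
        · by_cases hiR : i ∈ R
          · simp [mem_trv, hq, hiR, him]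
          · simp [mem_trv, hq, hiR, him]
      rw [e]
      have s1 := hr.sub (insert (m, !a) (trv (J \ R) f)) C (trv (J \ R) f) Cb
        (Finset.subset_insert _ _) hDC (by rw [hCbins]; grind)
      have s2 := hr.sub (trv R h ∪ insert (m, !a) (trv (J \ R) f)) Cb
        (insert (m, !a) (trv (J \ R) f)) (trv R h ∪ Cb) Finset.subset_union_right
        (by rw [hCbins]; exact Finset.insert_subset_insert _ hDC) (by grind)
      have s3 := hr.le_card (trv R h ∪ insert (m, !a) (trv (J \ R) f))
      have s4 := Finset.card_union_le (trv R h) (insert (m, !a) (trv (J \ R) f))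
      have s5 := Finset.card_insert_le (m, !a) (trv (J \ R) f)
      rw [card_trv] at s4 s5
      omega
    have mid : Cnn r J (q f) (q g) := by
      have indK : ∀ f, r (trv J f) = J.card → r (trv K f) = K.card := by
        intro f hf
        have e1 := hr.union_le (trv K f) (trv (J \ K) f)
        have e2 := hr.le_card (trv K f)
        have e3 := hr.mono (A := trv J f) (B := trv K f ∪ trv (J \ K) f) (by
          rintro ⟨i, b⟩; simp only [mem_trv, Finset.mem_union, Finset.mem_sdiff]; tauto)
        have := Finset.card_sdiff_add_card_eq_card hKJJ
        rw [card_trv] at e1 e2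
        omega
      have hDc : (J \ K).card = R.card + 1 := by
        have := Finset.card_sdiff_add_card_eq_card hKJJ
        omega
      have memD : ∀ i b, (i, b) ∈ trv (J \ K) (q f) ↔ (i ∈ R ∧ h i = b) ∨ (i = m ∧ b = !a) := by
        intro i b
        have := fun h : i ∈ R => Finset.disjoint_left.1 hdis h
        simp only [mem_trv, Finset.mem_sdiff, hmem, hq]
        by_cases him : i = m
        · subst him
          simp [hmR, hmK, eq_comm]
        · by_cases hiR : i ∈ R
          · simp [hiR, him, this hiR]
          · simp [hiR, him]
      have big : r (prs K) + (R.card + 1) ≤ r (prs K ∪ trv (J \ K) (q f)) := by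
        have eq1 : C ∪ trv (J \ K) (q f) = trv R h ∪ Cb := by
          rw [hCbins]
          ext ⟨i, b⟩
          simp only [Finset.mem_union, memD, mem_trv, Finset.mem_insert, Prod.mk.injEq]
          tauto
        rcases K.eq_empty_or_nonempty with hK0 | hK0
        · have z : r (prs K) = 0 := by simp [hK0, prs, hr.empty]
          have e1 := hr.unit (m, a) (prs K ∪ trv (J \ K) (q f))
          have e2 : insert (m, a) (prs K ∪ trv (J \ K) (q f)) = C ∪ trv (J \ K) (q f) := by
            rw [hC]; grind
          rw [e2, eq1] at e1
          have : K.card = 0 := by simp [hK0]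
          omega
        · have e1 := hH K hKJJ hK0
          have sC : prs K ⊆ C := by rw [hC]; exact Finset.subset_union_left
          have e2 := hr.mono sC
          have e3 := hr.sub (prs K ∪ trv (J \ K) (q f)) C (prs K) (C ∪ trv (J \ K) (q f))
            Finset.subset_union_left sC (by grind)
          rw [eq1] at e3
          omega
      have l := lift_conn hr hKJJ (q f) (ρ := r) (p := f) (q := g) (by
          intro Z hZ
          have := hr.sub (Z ∪ trv (J \ K) (q f)) (prs K) Z (prs K ∪ trv (J \ K) (q f))
            Finset.subset_union_left hZ (by grind)
          omega) (ih K.card (by omega) _ hr K rfl (fun I hI => hH I (hI.trans hKJJ)) f g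
            (indK f hf) (indK g hg))
      have ne : ∀ i, i ∈ K → i ∉ R ∧ i ≠ m := by
        intro i hi
        exact ⟨fun h => Finset.disjoint_left.1 hdis h hi, fun h => hmK (h ▸ hi)⟩
      refine (Cnn.of_eq ?_).trans (l.trans (Cnn.of_eq ?_))
      · intro i hi
        by_cases hiK : i ∈ K
        · simp [hq, hiK, ne i hiK]
        · simp [hiK]
      · intro i hi
        by_cases hiK : i ∈ K
        · simp [hq, hiK, ne i hiK]
        · by_cases him : i = m
          · subst him; simp [hq, hmK]
          · have : i ∈ R := by have := (hmem i).1 hi; tauto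
            simp [hq, hiK, him, this]
    exact (half f hfm hf).trans (mid.trans (half g hgm hg).symmetric)
  intro f g hf hg
  by_cases hfg : f m = g m
  · exact face (g m) f g hfg rfl hf hg
  have hP : r (prs {m}) = 2 := by
    have e1 := hH {m} (by simpa using hm) (by simp)
    have e2 := hr.le_card (prs {m})
    simp [prs] at e1 e2 ⊢
    omega
  obtain ⟨h, hh⟩ := rado (J.erase m).card _ (hr.contract (prs {m})) (J.erase m) rfl (by
    intro I hI
    have hmI : m ∉ I := fun h => by simpa using hI h
    have e1 := hH (insert m I) (by grind) (by simp)
    rw [Finset.card_insert_of_notMem hmI] at e1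
    have e2 : prs (insert m I) = prs I ∪ prs {m} := by
      ext ⟨i, b⟩; simp only [Finset.mem_union, mem_prs, Finset.mem_insert, Finset.mem_singleton]; tauto
    rw [e2] at e1
    push_cast at e1
    try simp only
    omega)
  try simp only at hh
  have memu : ∀ a i b, (i, b) ∈ trv J (Function.update h m a) ↔ (i, b) ∈ trv (J.erase m) h ∨ (i = m ∧ b = a) := by
    intro a i b
    by_cases hi : i = m
    · subst hi; simp [mem_trv, hm, eq_comm]
    · simp [mem_trv, hi]
  have hu : ∀ a, r (trv J (Function.update h m a)) = J.card := by
    intro a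
    have e1 := hr.le_card (trv J (Function.update h m a))
    have e2 := hr.unit (m, !a) (trv J (Function.update h m a))
    have e3 : insert (m, !a) (trv J (Function.update h m a)) = trv (J.erase m) h ∪ prs {m} := by
      ext ⟨i, b⟩
      simp only [Finset.mem_insert, memu, Finset.mem_union, mem_prs, Finset.mem_singleton,
        Prod.mk.injEq]
      cases a <;> cases b <;> simp <;> tauto
    rw [e3] at e2
    rw [card_trv] at e1
    omega
  refine (face _ f (Function.update h m (f m)) rfl (by simp) hf (hu _)).trans
    (Relation.ReflTransGen.head ?_ (face _ (Function.update h m (g m)) g (by simp) rfl (hu _) hg))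
  right
  have e3 : trv J (Function.update h m (f m)) ∪ trv J (Function.update h m (g m))
      = trv (J.erase m) h ∪ prs {m} := by
    ext ⟨i, b⟩
    simp only [memu, Finset.mem_union, mem_prs, Finset.mem_singleton]
    revert hfg
    generalize f m = x
    generalize g m = y
    cases x <;> cases y <;> cases b <;> simp <;> tauto
  rw [e3]
  have e4 := hr.le_card (trv (J.erase m) h ∪ prs {m})
  have e5 := Finset.card_union_le (trv (J.erase m) h) (prs {m})
  have e6 : (prs {m}).card = 2 := by simp [prs]
  rw [card_trv] at e5
  omega

end pairs

lemma IsRk.trunc {β : Type*} [DecidableEq β] {r : Finset β → ℤ} (h : IsRk r) (k : ℤ) (hk : 0 ≤ k) :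
    IsRk (fun X => min (r X) k) where
  empty := by simp [h.empty, hk]
  sub A B D E h1 h2 h3 := by
    have e1 := h.sub A B D E h1 h2 h3
    have e2 := h.mono h1
    have e3 := h.mono h2
    try simp only
    omega
  unit x A := by
    have := h.unit x A
    try simp only
    omega

lemma IsRk.dual {β : Type*} [DecidableEq β] {r : Finset β → ℤ} (h : IsRk r) (E : Finset β) :
    IsRk (fun X => (X.card : ℤ) + r (E \ X) - r E) where
  empty := by simp
  sub A B D F h1 h2 h3 := by
    have e1 := h.sub (E \ A) (E \ B) (E \ (A ∪ B)) (E \ (A ∩ B)) (by grind) (by grind) (by grind)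
    have e2 := Finset.card_union_add_card_inter A B
    have e3 := h.union_le (E \ (A ∪ B)) ((A ∪ B) \ F)
    have e4 := h.mono (A := E \ F) (B := E \ (A ∪ B) ∪ ((A ∪ B) \ F)) (by grind)
    have e5 := Finset.card_sdiff_add_card_eq_card h3
    have h4 : D ⊆ A ∩ B := Finset.subset_inter h1 h2
    have e6 := h.union_le (E \ (A ∩ B)) ((A ∩ B) \ D)
    have e7 := h.mono (A := E \ D) (B := E \ (A ∩ B) ∪ ((A ∩ B) \ D)) (by grind)
    have e8 := Finset.card_sdiff_add_card_eq_card h4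
    omega
  unit x A := by
    have e1 := Finset.card_insert_le x A
    have e2 := h.mono (A := E \ insert x A) (B := E \ A) (by grind)
    try simp only
    omega

def lft {α : Type*} [Fintype α] [DecidableEq α] (c : Bool) (X : Finset (α × Bool)) : Finset α :=
  Finset.univ.filter fun i => (i, c) ∈ X

lemma mem_lft {α : Type*} [Fintype α] [DecidableEq α] {c : Bool} {X : Finset (α × Bool)} {i : α} :
    i ∈ lft c X ↔ (i, c) ∈ X := by simp [lft]

lemma IsRk.sum {α : Type*} [Fintype α] [DecidableEq α] {r s : Finset α → ℤ} (hr : IsRk r)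
    (hs : IsRk s) : IsRk (fun X : Finset (α × Bool) => r (lft true X) + s (lft false X)) where
  empty := by
    have : ∀ c, lft c (∅ : Finset (α × Bool)) = ∅ := by intro c; simp [lft]
    simp [this, hr.empty, hs.empty]
  sub A B D F h1 h2 h3 := by
    have m : ∀ c {X Y : Finset (α × Bool)}, X ⊆ Y → lft c X ⊆ lft c Y := by
      intro c X Y h i; rw [mem_lft, mem_lft]; exact @h _
    have u : ∀ c, lft c F ⊆ lft c A ∪ lft c B := by
      intro c i; rw [Finset.mem_union, mem_lft, mem_lft, mem_lft, ← Finset.mem_union]; exact @h3 _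
    have e1 := hr.sub _ _ _ _ (m true h1) (m true h2) (u true)
    have e2 := hs.sub _ _ _ _ (m false h1) (m false h2) (u false)
    linarith
  unit x A := by
    rcases x with ⟨i, b⟩
    have e1 : lft b (insert (i, b) A) = insert i (lft b A) := by
      ext j; simp [mem_lft]
    have e2 : lft (!b) (insert (i, b) A) = lft (!b) A := by
      ext j; cases b <;> simp [mem_lft]
    cases b
    · have := hs.unit i (lft false A)
      simp only [Bool.not_false] at e2
      simp only [e1, e2]; linarith
    · have := hr.unit i (lft true A)
      simp only [Bool.not_true] at e2
      simp only [e1, e2]; linarith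

lemma mrank_eq {α : Type*} [DecidableEq α] (M : Matroid α) (X : Finset α) :
    ((mrank M X : ℕ) : ℕ∞) = M.eRk (X : Set α) := by
  apply le_antisymm
  · obtain ⟨S, hS, hSs⟩ := Finset.exists_mem_eq_sup X.powerset ⟨∅, by simp⟩
      (fun S : Finset α => if M.Indep ↑S then S.card else 0)
    rw [mrank, hSs]
    rw [Finset.mem_powerset] at hS
    split_ifs with hi
    · have := hi.encard_le_eRk_of_subset (X := (X : Set α)) (by exact_mod_cast hS)
      simpa using this
    · simp
  · rw [Matroid.eRk_le_iff]
    intro I hI hInd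
    have hfin : I.Finite := X.finite_toSet.subset hI
    lift I to Finset α using hfin
    rw [Set.encard_coe_eq_coe_finsetCard]
    have := Finset.le_sup (f := fun S : Finset α => if M.Indep ↑S then S.card else 0)
      (Finset.mem_powerset.2 (by exact_mod_cast hI : I ⊆ X))
    simp only [hInd, if_true] at this
    exact_mod_cast this

lemma mrank_isRk {α : Type*} [DecidableEq α] (M : Matroid α) :
    IsRk (fun X => (mrank M X : ℤ)) where
  empty := by
    have := mrank_eq M ∅
    simp at this
    simp [this]
  sub A B D F h1 h2 h3 := by
    have e1 := M.eRk_inter_add_eRk_union_le (A : Set α) B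
    have e2 := M.eRk_mono (show (D : Set α) ⊆ ↑A ∩ ↑B by exact_mod_cast Finset.subset_inter h1 h2)
    have e3 := M.eRk_mono (show (F : Set α) ⊆ ↑A ∪ ↑B by exact_mod_cast h3)
    have e4 := (add_le_add e3 e2).trans ((add_comm _ _).le.trans e1)
    rw [← mrank_eq, ← mrank_eq, ← mrank_eq, ← mrank_eq] at e4
    exact_mod_cast e4
  unit x A := by
    have := M.eRk_insert_le_add_one x (A : Set α)
    rw [← Finset.coe_insert, ← mrank_eq, ← mrank_eq] at this
    exact_mod_cast this

lemma mrank_indep {α : Type*} [DecidableEq α] (M : Matroid α) (X : Finset α) :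
    M.Indep (X : Set α) ↔ mrank M X = X.card := by
  rw [Matroid.indep_iff_eRk_eq_encard_of_finite X.finite_toSet, ← mrank_eq,
    Set.encard_coe_eq_coe_finsetCard]
  exact_mod_cast Iff.rfl

/-- If `r(M|X) + r(N|(V − X)) ≥ k + 1` for every `X ⊆ V` such that `V − X` is a flat of
`N` of rank at most `k − 1`, then the reconfiguration graph `RG(M, N; k)` on common
independent `k`-sets is connected. -/
theorem stmt_5 {α : Type*} [Fintype α] [DecidableEq α]
    (M N : Matroid α) (hME : M.E = Set.univ) (hNE : N.E = Set.univ)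
    (k : ℕ) (hk : 1 ≤ k)
    (h : ∀ X : Finset α, IsFlatF N (Finset.univ \ X) →
      mrank N (Finset.univ \ X) ≤ k - 1 →
      k + 1 ≤ mrank M X + mrank N (Finset.univ \ X))
    (S T : Finset α) (hS : MIVertex M N k S) (hT : MIVertex M N k T) :
    Relation.ReflTransGen (MIAdj M N k) S T := by

  have hrM := mrank_isRk M
  have hrN := mrank_isRk N
  obtain ⟨E, hE⟩ : ∃ E : Finset α, E = Finset.univ.filter (fun i => 1 ≤ mrank M {i}) := ⟨_, rfl⟩
  have vE : ∀ S : Finset α, M.Indep (S : Set α) → S ⊆ E := by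
    intro S hS i hi
    rw [hE, Finset.mem_filter]
    have : M.Indep (({i} : Finset α) : Set α) := hS.subset (by simpa using hi)
    rw [mrank_indep] at this
    simp [this]
  have hL : ∀ X : Finset α, mrank M (X \ E) = 0 := by
    intro X
    obtain ⟨I, hI⟩ := M.exists_isBasis' ((X \ E : Finset α) : Set α)
    have hI0 : I = ∅ := by
      by_contra hne
      obtain ⟨i, hi⟩ := Set.nonempty_iff_ne_empty.2 hne
      have h1 : M.Indep (({i} : Finset α) : Set α) := hI.indep.subset (by simpa using hi)
      have h2 := vE _ h1 (Finset.mem_singleton_self i)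
      have h3 := hI.subset hi
      simp at h3
      exact h3.2 h2
    have := hI.encard_eq_eRk
    rw [← mrank_eq, hI0] at this
    rw [Set.encard_empty] at this
    exact_mod_cast this.symm
  have hcS : ∀ S, MIVertex M N k S → S.card = k ∧ mrank M S = k ∧ mrank N S = k ∧ S ⊆ E := by
    rintro S ⟨h1, h2, h3⟩
    have := vE S h2
    rw [mrank_indep] at h2 h3
    exact ⟨h1, by omega, by omega, this⟩
  have htM := hrM.trunc (k + 1) (by positivity)
  have htN := hrN.trunc k (by positivity)
  obtain ⟨r, hrdef⟩ : ∃ r : Finset (α × Bool) → ℤ, r = fun X =>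
    min (mrank M (lft true X) : ℤ) (k + 1) +
      (((lft false X).card : ℤ) + min (mrank N (E \ lft false X) : ℤ) k - min (mrank N E : ℤ) k) :=
    ⟨_, rfl⟩
  have hr : IsRk r := by rw [hrdef]; exact htM.sum (htN.dual E)
  have hEk : min (mrank N E : ℤ) k = k := by
    have h1 := hcS S hS
    have := hrN.mono h1.2.2.2
    try simp only at this
    omega
  rw [hEk] at hrdef
  -- key inequality
  have hkey : ∀ I ⊆ E, mrank N (E \ I) < k → k + 1 ≤ mrank M I + mrank N (E \ I) := by
    intro I hI hlt
    obtain ⟨F, hF, hFmax⟩ := (Finset.univ.filter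
      (fun F : Finset α => E \ I ⊆ F ∧ mrank N F = mrank N (E \ I))).exists_max_image Finset.card
      ⟨E \ I, by simp⟩
    simp only [Finset.mem_filter, Finset.mem_univ, true_and] at hF hFmax
    have hFF : Finset.univ \ (Finset.univ \ F) = F := by simp
    have e := h (Finset.univ \ F) (by
      rw [hFF]
      intro x hx
      have m1 := hrN.mono (Finset.subset_insert x F)
      try simp only at m1
      by_contra hcon
      have := hFmax (insert x F) ⟨hF.1.trans (Finset.subset_insert _ _), by omega⟩
      rw [Finset.card_insert_of_notMem hx] at this
      omega) (by rw [hFF]; omega)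
    rw [hFF, hF.2] at e
    have s := hrM.sub I (Finset.univ \ E) ∅ (Finset.univ \ F) (by simp) (by simp) (by
      have := hF.1
      intro x hx
      have h1 : x ∉ F := by simpa using hx
      by_cases hxE : x ∈ E
      · by_cases hxI : x ∈ I
        · simp [hxI]
        · exact absurd (this (by simp [hxE, hxI])) h1
      · simp [hxE])
    have := hL Finset.univ
    try simp only at s
    omega
  have hdr : ∀ I ⊆ E, I.Nonempty → (I.card : ℤ) + 1 ≤ r (prs I) := by
    intro I hI hIn
    have e1 : ∀ c, lft c (prs I) = I := by intro c; ext i; simp [mem_lft, mem_prs]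
    rw [hrdef]
    simp only [e1]
    obtain ⟨i, hi⟩ := hIn
    have h1 : 1 ≤ mrank M {i} := by
      have := hI hi
      rw [hE, Finset.mem_filter] at this
      exact this.2
    have h2 := hrM.mono (A := {i}) (B := I) (by simpa using hi)
    try simp only at h2
    have h3 := hkey I hI
    by_cases hlt : mrank N (E \ I) < k
    · have := h3 hlt
      omega
    · omega
  -- sets associated to boolean functions
  have hl1 : ∀ f, lft true (trv E f) = E.filter (fun i => f i = true) := by
    intro f; ext i; simp [mem_lft, mem_trv]
  have hl0 : ∀ f, lft false (trv E f) = E \ E.filter (fun i => f i = true) := by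
    intro f; ext i; simp [mem_lft, mem_trv]; tauto
  obtain ⟨σ, hσ⟩ : ∃ σ : (α → Bool) → Finset α, σ = fun f => E.filter (fun i => f i = true) :=
    ⟨_, rfl⟩
  have hl1 : ∀ f, lft true (trv E f) = σ f := by rw [hσ]; exact hl1
  have hl0 : ∀ f, lft false (trv E f) = E \ σ f := by rw [hσ]; exact hl0
  have hσE : ∀ f, σ f ⊆ E := by intro f; rw [hσ]; exact Finset.filter_subset _ _
  have hχ : ∀ S ⊆ E, σ (fun i => decide (i ∈ S)) = S := by
    intro S hS; rw [hσ]; ext i; simp; exact @hS i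
  have hind : ∀ S, MIVertex M N k S → r (trv E (fun i => decide (i ∈ S))) = E.card := by
    intro S hS
    obtain ⟨h1, h2, h3, h4⟩ := hcS S hS
    rw [hrdef]
    simp only [hl1, hl0, hχ S h4]
    rw [Finset.sdiff_sdiff_eq_self h4, h2, h3]
    have := Finset.card_sdiff_add_card_eq_card h4
    omega
  have path := dragon E.card r hr E rfl hdr _ _ (hind S hS) (hind T hT)
  -- structure of a step
  have hstep : ∀ f g, Stp r E f g → σ f = σ g ∨
      ((σ f ∪ σ g).card ≤ k + 1 ∧ M.Indep ((σ f ∪ σ g : Finset α) : Set α) ∧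
        (σ f ∩ σ g).card = k ∧ N.Indep ((σ f ∩ σ g : Finset α) : Set α) ∧
        (σ f ⊆ σ g ∨ σ g ⊆ σ f)) := by
    intro f g hfg
    by_cases heq : σ f = σ g
    · exact Or.inl heq
    right
    rcases hfg with hfg | ⟨h1, h2⟩
    · exact absurd (by rw [← hl1, ← hl1, hfg]) heq
    have hlu : ∀ c (X Y : Finset (α × Bool)), lft c (X ∪ Y) = lft c X ∪ lft c Y := by
      intro c X Y; ext i; simp [mem_lft]
    have hcard : ∀ X : Finset (α × Bool), X.card = (lft true X).card + (lft false X).card := by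
      intro X
      have e : X = (lft true X).image (fun i => (i, true)) ∪ (lft false X).image (fun i => (i, false)) := by
        ext ⟨i, b⟩; cases b <;> simp [mem_lft]
      conv_lhs => rw [e]
      rw [Finset.card_union_of_disjoint, Finset.card_image_of_injective, Finset.card_image_of_injective]
      · intro a b h; simpa using h
      · intro a b h; simpa using h
      · rw [Finset.disjoint_left]; rintro ⟨i, b⟩; simp; grind
    have e0 : E \ σ f ∪ E \ σ g = E \ (σ f ∩ σ g) := by
      ext i; simp only [Finset.mem_union, Finset.mem_sdiff, Finset.mem_inter]; tauto
    have hiE : σ f ∩ σ g ⊆ E := Finset.inter_subset_left.trans (hσE f)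
    rw [hcard] at h1 h2
    rw [hrdef] at h1
    simp only [hlu, hl1, hl0, e0, Finset.sdiff_sdiff_eq_self hiE] at h1 h2
    have c1 := Finset.card_sdiff_add_card_eq_card hiE
    have c2 := hrM.le_card (σ f ∪ σ g)
    have c3 := hrN.le_card (σ f ∩ σ g)
    have c4 := Finset.card_union_add_card_inter (σ f) (σ g)
    try simp only at c2 c3
    have c5 : (σ f ∩ σ g).card < (σ f ∪ σ g).card := by
      apply Finset.card_lt_card
      refine ⟨Finset.inter_subset_left.trans Finset.subset_union_left, fun hc => heq ?_⟩
      exact Finset.Subset.antisymm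
        (Finset.subset_union_left.trans (hc.trans Finset.inter_subset_right))
        (Finset.subset_union_right.trans (hc.trans Finset.inter_subset_left))
    refine ⟨by omega, by rw [mrank_indep]; omega, by omega, by rw [mrank_indep]; omega, ?_⟩
    have c6 : (σ f).card = k ∨ (σ g).card = k := by
      have a1 := Finset.card_le_card (Finset.inter_subset_left (s₁ := σ f) (s₂ := σ g))
      have a2 := Finset.card_le_card (Finset.inter_subset_right (s₁ := σ f) (s₂ := σ g))
      omega
    rcases c6 with c6 | c6
    · left
      have := Finset.eq_of_subset_of_card_le (Finset.inter_subset_left (s₁ := σ f) (s₂ := σ g))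
        (by omega)
      rw [← this]; exact Finset.inter_subset_right
    · right
      have := Finset.eq_of_subset_of_card_le (Finset.inter_subset_right (s₁ := σ f) (s₂ := σ g))
        (by omega)
      rw [← this]; exact Finset.inter_subset_left
  have inv : ∀ g, Relation.ReflTransGen (Stp r E) (fun i => decide (i ∈ S)) g →
      ∀ Z ⊆ σ g, MIVertex M N k Z → Relation.ReflTransGen (MIAdj M N k) S Z := by
    intro g hg
    induction hg with
    | refl =>
      intro Z hZ hZv
      rw [hχ S (hcS S hS).2.2.2] at hZ
      rw [Finset.eq_of_subset_of_card_le hZ (by rw [hS.1, hZv.1])]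
    | tail _ hbc ih =>
      rename_i b c _
      intro Z hZ hZv
      rcases hstep _ _ hbc with heq | ⟨h1, h2, h3, h4, h5 | h5⟩
      · exact ih Z (by rw [heq]; exact hZ) hZv
      · rw [Finset.union_eq_right.2 h5] at h1 h2
        rw [Finset.inter_eq_left.2 h5] at h3 h4
        have bv : MIVertex M N k (σ b) := ⟨h3, h2.subset (by exact_mod_cast h5), h4⟩
        have p := ih (σ b) subset_rfl bv
        by_cases hZb : Z = σ b
        · rw [hZb]; exact p
        have hu : σ b ∪ Z ⊆ σ c := Finset.union_subset h5 hZ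
        refine p.tail ⟨bv, hZv, h2.subset (by exact_mod_cast hu), ?_⟩
        have u1 := Finset.card_le_card hu
        have u2 : (σ b).card < (σ b ∪ Z).card := by
          apply Finset.card_lt_card
          refine ⟨Finset.subset_union_left, fun hc => hZb ?_⟩
          exact Finset.eq_of_subset_of_card_le (Finset.subset_union_right.trans hc)
            (by rw [hZv.1, h3])
        omega
      · exact ih Z (hZ.trans h5) hZv
  exact inv _ path T (by rw [hχ T (hcS T hT).2.2.2]) hT
end

section
/- Let G be a finite simple graph and let 𝒱 = {V_1, …, V_n} be a partition of V(G). If for every nonempty subset I ⊆ {1,…,n}, every set X ⊆ V_I that strongly dominates V_I in the induced subgraph G[V_I] satisfies |X| ≥ 2|I| + 1 (i.e., the strong domination number of G[V_I] is at least 2|I| + 1), then the reconfiguration graph RG(G, 𝒱) is connected. -/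
/-- `S` is an independent set of the graph `G`. -/
def IndepSet {V : Type*} (G : SimpleGraph V) (S : Finset V) : Prop :=
  ∀ u ∈ S, ∀ v ∈ S, ¬ G.Adj u v

/-- `S` is an independent transversal of `G` with respect to the vertex partition
`P : Fin n → Finset V`: an independent set meeting each class in exactly one vertex. -/
def IsIndepTransversal {V : Type*} [DecidableEq V] (G : SimpleGraph V) {n : ℕ}
    (P : Fin n → Finset V) (S : Finset V) : Prop :=
  IndepSet G S ∧ ∀ i, (S ∩ P i).card = 1

/-- Adjacency in the reconfiguration graph `RG(G, 𝒱)`: two independent transversals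
are adjacent if their union is an independent set of cardinality `n + 1`. -/
def ITAdj {V : Type*} [DecidableEq V] (G : SimpleGraph V) {n : ℕ}
    (P : Fin n → Finset V) (S T : Finset V) : Prop :=
  IsIndepTransversal G P S ∧ IsIndepTransversal G P T ∧
    IndepSet G (S ∪ T) ∧ (S ∪ T).card = n + 1

open Classical in
/-- Simplicial boundary over `ZMod 2` of a chain. -/
noncomputable def bdry {V : Type*} [Fintype V] (c : Finset V → ZMod 2) : Finset V → ZMod 2 :=
  fun τ => ∑ x ∈ Finset.univ.filter (fun x => x ∉ τ), c (insert x τ)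

open Classical in
/-- Join of a chain with a vertex. -/
noncomputable def joinv {V : Type*} (w : V) (f : Finset V → ZMod 2) : Finset V → ZMod 2 :=
  fun σ => if w ∈ σ then f (σ.erase w) else 0

/-- The chain is supported on independent `s`-subsets of `W`. -/
def Supp {V : Type*} (H : SimpleGraph V) (W : Finset V) (s : ℕ) (c : Finset V → ZMod 2) : Prop :=
  ∀ σ, c σ ≠ 0 → IndepSet H σ ∧ σ ⊆ W ∧ σ.card = s

theorem zmod2_add_self (a : ZMod 2) : a + a = 0 := CharTwo.add_self_eq_zero a

theorem bdry_add {V : Type*} [Fintype V] (f g : Finset V → ZMod 2) :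
    bdry (f + g) = bdry f + bdry g := by
  funext τ
  simp [bdry, Finset.sum_add_distrib]

theorem bdry_sum {V ι : Type*} [Fintype V] (I : Finset ι) (f : ι → Finset V → ZMod 2) :
    bdry (∑ i ∈ I, f i) = ∑ i ∈ I, bdry (f i) := by
  classical
  induction I using Finset.induction_on with
  | empty => funext τ; simp [bdry]
  | insert a s ha ih => rw [Finset.sum_insert ha, Finset.sum_insert ha, bdry_add, ih]

theorem bdry_joinv {V : Type*} [Fintype V] (w : V) (f : Finset V → ZMod 2)
    (hf : ∀ σ, w ∈ σ → f σ = 0) : bdry (joinv w f) = f + joinv w (bdry f) := by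
  classical
  funext τ
  by_cases hw : w ∈ τ
  · simp only [bdry, joinv, Pi.add_apply, hw, if_true, hf τ hw, zero_add, Finset.mem_insert, or_true]
    have : Finset.univ.filter (fun x => x ∉ τ.erase w)
        = insert w (Finset.univ.filter (fun x => x ∉ τ)) := by
      ext x
      by_cases h : x = w <;> simp [h]
    rw [this, Finset.sum_insert (by simp [hw]), hf _ (Finset.mem_insert_self _ _), zero_add]
    apply Finset.sum_congr rfl
    intro x hx
    have hx' : x ∉ τ := by simpa using hx
    have : x ≠ w := fun h => hx' (h ▸ hw)
    rw [Finset.erase_insert_of_ne this]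
  · simp only [bdry, joinv, Pi.add_apply, hw, if_false, add_zero]
    rw [Finset.sum_eq_single w]
    · simp [hw]
    · intro x _ hx
      rw [if_neg]
      simp [hw, Ne.symm hx]
    · simp [hw]

theorem bdry_adjoint {V : Type*} [Fintype V] [DecidableEq V] (F c : Finset V → ZMod 2) :
    ∑ τ, F τ * bdry c τ = ∑ σ, c σ * ∑ x ∈ σ, F (σ.erase x) := by
  classical
  simp only [bdry, Finset.mul_sum]
  rw [Finset.sum_sigma', Finset.sum_sigma']
  refine Finset.sum_bij' (fun p _ => ⟨insert p.2 p.1, p.2⟩) (fun p _ => ⟨p.1.erase p.2, p.2⟩)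
    ?_ ?_ ?_ ?_ ?_
  · rintro ⟨τ, x⟩ h; simp
  · rintro ⟨τ, x⟩ h; simp
  · rintro ⟨τ, x⟩ h
    have : x ∉ τ := by simpa using h
    simp [this]
  · rintro ⟨τ, x⟩ h
    have : x ∈ τ := by simpa using h
    simp [this]
  · rintro ⟨τ, x⟩ h
    have : x ∉ τ := by simpa using h
    simp only [Finset.erase_insert this, mul_comm]
    congr!

theorem acyc {V : Type*} [Fintype V] (s : ℕ) : ∀ (W : Finset V) (H : SimpleGraph V),
    (∀ X ⊆ W, (∀ v ∈ W, ∃ u ∈ X, H.Adj u v) → 2 * s + 1 ≤ X.card) →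
    ∀ z, Supp H W s z → bdry z = 0 → ∃ c, Supp H W (s + 1) c ∧ bdry c = z := by
  classical
  induction s with
  | zero =>
    intro W H hd z hz _
    have hW : W.Nonempty := by
      rw [Finset.nonempty_iff_ne_empty]
      rintro rfl
      have := hd ∅ (by simp) (by simp)
      simp at this
    obtain ⟨w, hw⟩ := hW
    have hz0 : ∀ σ, σ ≠ ∅ → z σ = 0 := by
      intro σ hσ
      by_contra h
      exact hσ (Finset.card_eq_zero.1 (hz σ h).2.2)
    refine ⟨joinv w z, ?_, ?_⟩
    · intro σ hσ
      have h1 : w ∈ σ := by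
        by_contra h; exact hσ (by simp [joinv, h])
      have h2 : σ.erase w = ∅ := by
        by_contra h
        exact hσ (by simp [joinv, h1, hz0 _ h])
      have : σ = {w} := by rw [← Finset.insert_erase h1, h2]; rfl
      subst this
      refine ⟨?_, by simpa using hw, by simp⟩
      intro a ha b hb
      simp only [Finset.mem_singleton] at ha hb
      subst ha; subst hb
      exact H.loopless.irrefl _
    · rw [bdry_joinv _ _ (fun σ h => hz0 σ (Finset.ne_empty_of_mem h))]
      funext τ
      simp only [Pi.add_apply, joinv]
      have : bdry z (τ.erase w) = 0 := by
        unfold bdry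
        exact Finset.sum_eq_zero fun x _ => hz0 _ (Finset.insert_ne_empty _ _)
      simp [this]
  | succ s ih =>
    intro W H
    induction H using WellFoundedLT.induction with
    | ind H ihH =>
    intro hd z hz hbz
    by_cases he : ∃ u ∈ W, ∃ v ∈ W, H.Adj u v
    · obtain ⟨u, hu, v, hv, huv⟩ := he
      have hne : u ≠ v := huv.ne
      obtain ⟨K, hK⟩ : ∃ K : SimpleGraph V, K = H.deleteEdges {s(u, v)} := ⟨_, rfl⟩
      have hKadj : ∀ a b, K.Adj a b ↔ H.Adj a b ∧ ¬ ((a = u ∧ b = v) ∨ (a = v ∧ b = u)) := by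
        intro a b
        rw [hK]
        simp [SimpleGraph.deleteEdges_adj]
      have hKle : K ≤ H := fun a b h => ((hKadj a b).1 h).1
      have hKlt : K < H := lt_of_le_of_ne hKle (by
        rintro h
        have := (hKadj u v).1 (h ▸ huv)
        simp at this)
      obtain ⟨c, hc, hcz⟩ := ihH K hKlt
        (fun X hX hX' => hd X hX fun v hv => by
          obtain ⟨u, hu, h⟩ := hX' v hv
          exact ⟨u, hu, hKle h⟩) z
        (fun σ hσ => ⟨fun a ha b hb h => (hz σ hσ).1 a ha b hb (hKle h), (hz σ hσ).2⟩) hbz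
      -- the link part
      obtain ⟨d, hdd⟩ : ∃ d : Finset V → ZMod 2,
        d = fun τ => if u ∈ τ ∨ v ∈ τ then 0 else c (insert u (insert v τ)) := ⟨_, rfl⟩
      obtain ⟨c0, hc0⟩ : ∃ c0 : Finset V → ZMod 2,
        c0 = fun σ => if u ∈ σ ∧ v ∈ σ then 0 else c σ := ⟨_, rfl⟩
      have hdu : ∀ σ, u ∈ σ → d σ = 0 := fun σ h => by simp [hdd, h]
      have hdv : ∀ σ, v ∈ σ → d σ = 0 := fun σ h => by simp [hdd, h]
      have hsplit : c = c0 + joinv u (joinv v d) := by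
        funext σ
        simp only [hc0, hdd, joinv, Pi.add_apply]
        by_cases h1 : u ∈ σ
        · by_cases h2 : v ∈ σ
          · have h3 : v ∈ σ.erase u := Finset.mem_erase.2 ⟨hne.symm, h2⟩
            simp [h1, h2, h3, Finset.insert_erase h3, Finset.insert_erase h1, hne.symm]
          · simp [h1, h2]
        · simp [h1]
      have hbd : bdry d = 0 := by
        funext τ
        by_cases ht : u ∈ τ ∨ v ∈ τ
        · simp only [bdry, Pi.zero_apply]
          apply Finset.sum_eq_zero
          intro x _
          rcases ht with h | h
          · exact hdu _ (Finset.mem_insert_of_mem h)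
          · exact hdv _ (Finset.mem_insert_of_mem h)
        · have hz0 : z (insert u (insert v τ)) = 0 := by
            by_contra h
            exact (hz _ h).1 u (by simp) v (by simp) huv
          rw [← hcz] at hz0
          push Not at ht
          simp only [Pi.zero_apply]
          rw [← hz0]
          simp only [bdry]
          symm
          apply Finset.sum_subset_zero_on_sdiff
          · intro x hx
            simp only [Finset.mem_filter, Finset.mem_insert, not_or, Finset.mem_univ, true_and] at hx ⊢
            exact hx.2.2
          · intro x hx
            simp only [Finset.mem_sdiff, Finset.mem_filter, Finset.mem_insert, not_or,
              Finset.mem_univ, true_and] at hx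
            have : x = u ∨ x = v := by
              by_contra h
              push Not at h
              exact hx.2 ⟨h.1, h.2, hx.1⟩
            rcases this with rfl | rfl
            · exact hdu _ (by simp)
            · exact hdv _ (by simp)
          · intro x hx
            simp only [Finset.mem_filter, Finset.mem_insert, not_or, Finset.mem_univ, true_and] at hx
            simp only [hdd, Finset.mem_insert, ht.1, ht.2, or_false, Ne.symm hx.1, Ne.symm hx.2.1,
              if_false]
            congr 1
            ext y
            simp only [Finset.mem_insert]
            tauto
      obtain ⟨W', hW'⟩ : ∃ W' : Finset V, W' = W.filter (fun x => ¬ H.Adj u x ∧ ¬ H.Adj v x) :=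
        ⟨_, rfl⟩
      have huW' : u ∉ W' := by simp [hW', huv.symm]
      have hvW' : v ∉ W' := by simp [hW', huv]
      have hdS : Supp H W' s d := by
        intro τ hτ
        have hut : u ∉ τ := fun h => hτ (hdu _ h)
        have hvt : v ∉ τ := fun h => hτ (hdv _ h)
        have h1 : c (insert u (insert v τ)) ≠ 0 := by simpa [hdd, hut, hvt] using hτ
        obtain ⟨hi, hs, hcard⟩ := hc _ h1
        have key : ∀ a ∈ insert u (insert v τ), ∀ b ∈ τ, ¬ H.Adj a b := by
          intro a ha b hb h
          refine hi a ha b (by simp [hb]) ((hKadj a b).2 ⟨h, ?_⟩)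
          rintro (⟨-, rfl⟩ | ⟨-, rfl⟩)
          · exact hvt hb
          · exact hut hb
        refine ⟨fun a ha b hb => key a (by simp [ha]) b hb, ?_, ?_⟩
        · intro x hx
          rw [hW', Finset.mem_filter]
          exact ⟨hs (by simp [hx]), key u (by simp) x hx, key v (by simp) x hx⟩
        · rw [Finset.card_insert_of_notMem (by simp [hne, hut]),
            Finset.card_insert_of_notMem hvt] at hcard
          omega
      obtain ⟨f, hf, hfd⟩ := ih W' H (by
        intro X hX hdomX
        have h1 := hd (insert u (insert v X)) (by
          intro x hx
          simp only [Finset.mem_insert] at hx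
          rcases hx with rfl | rfl | hx
          · exact hu
          · exact hv
          · exact Finset.filter_subset _ _ (hW' ▸ hX hx)) (by
          intro x hx
          by_cases h1 : H.Adj u x
          · exact ⟨u, by simp, h1⟩
          by_cases h2 : H.Adj v x
          · exact ⟨v, by simp, h2⟩
          obtain ⟨y, hy, hyx⟩ := hdomX x (by simp [hW', hx, h1, h2])
          exact ⟨y, by simp [hy], hyx⟩)
        have h2 := Finset.card_insert_le u (insert v X)
        have h3 := Finset.card_insert_le v X
        omega) d hdS hbd
      have hfW : ∀ w, w ∉ W' → ∀ σ, w ∈ σ → f σ = 0 := by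
        intro w hw σ hσ
        by_contra h
        exact hw ((hf σ h).2.1 hσ)
      have hjoin : ∀ w ∈ W, w ∉ W' → (∀ x ∈ W', ¬ H.Adj w x) → Supp H W (s + 1 + 1) (joinv w f) := by
        intro w hwW hwW' hadj σ hσ
        have h1 : w ∈ σ := by
          by_contra h; exact hσ (by simp [joinv, h])
        have h2 : f (σ.erase w) ≠ 0 := by simpa [joinv, h1] using hσ
        obtain ⟨hi, hs, hcard⟩ := hf _ h2
        refine ⟨?_, ?_, ?_⟩
        · intro a ha b hb hab
          by_cases haw : a = w
          · subst haw
            exact hadj b (hs (Finset.mem_erase.2 ⟨hab.ne.symm, hb⟩)) hab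
          · by_cases hbw : b = w
            · subst hbw
              exact hadj a (hs (Finset.mem_erase.2 ⟨haw, ha⟩)) hab.symm
            · exact hi a (Finset.mem_erase.2 ⟨haw, ha⟩) b (Finset.mem_erase.2 ⟨hbw, hb⟩) hab
        · intro x hx
          by_cases hxw : x = w
          · exact hxw ▸ hwW
          · exact Finset.filter_subset _ _ (hW' ▸ hs (Finset.mem_erase.2 ⟨hxw, hx⟩))
        · rw [Finset.card_erase_of_mem h1] at hcard
          have := Finset.card_pos.2 ⟨w, h1⟩
          omega
      have hSu := hjoin u hu huW' (fun x hx => by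
        rw [hW', Finset.mem_filter] at hx; exact hx.2.1)
      have hSv := hjoin v hv hvW' (fun x hx => by
        rw [hW', Finset.mem_filter] at hx; exact hx.2.2)
      refine ⟨c0 + (joinv u f + joinv v f), ?_, ?_⟩
      · intro σ hσ
        by_cases h1 : joinv u f σ = 0
        · by_cases h2 : joinv v f σ = 0
          · have h3 : c0 σ ≠ 0 := by simpa [h1, h2] using hσ
            have h4 : ¬ (u ∈ σ ∧ v ∈ σ) := fun h => h3 (by simp [hc0, h])
            have h5 : c σ ≠ 0 := by simpa [hc0, h4] using h3
            refine ⟨?_, (hc σ h5).2⟩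
            intro a ha b hb hab
            refine (hc σ h5).1 a ha b hb ((hKadj a b).2 ⟨hab, ?_⟩)
            rintro (⟨rfl, rfl⟩ | ⟨rfl, rfl⟩)
            · exact h4 ⟨ha, hb⟩
            · exact h4 ⟨hb, ha⟩
          · exact hSv σ h2
        · exact hSu σ h1
      · have e1 : bdry c = bdry c0 + bdry (joinv u (joinv v d)) := by
          conv_lhs => rw [hsplit]
          rw [bdry_add]
        rw [hcz, bdry_joinv u (joinv v d) (by
          intro σ h
          simp only [joinv]
          rw [hdu _ (Finset.mem_erase.2 ⟨hne, h⟩)]; simp), bdry_joinv v d hdv, hbd] at e1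
        rw [bdry_add, bdry_add, bdry_joinv u f (hfW u huW'), bdry_joinv v f (hfW v hvW'), hfd]
        rw [e1]
        funext τ
        simp only [Pi.add_apply, joinv, Pi.zero_apply, ite_self, add_zero]
        have a1 := zmod2_add_self (f τ)
        linear_combination a1
    · push Not at he
      have hW : W.Nonempty := by
        rw [Finset.nonempty_iff_ne_empty]
        rintro rfl
        have := hd ∅ (by simp) (by simp)
        simp at this
      obtain ⟨w, hw⟩ := hW
      obtain ⟨z0, hz0⟩ : ∃ z0 : Finset V → ZMod 2, z0 = fun σ => if w ∈ σ then 0 else z σ := ⟨_, rfl⟩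
      have hz0w : ∀ σ, w ∈ σ → z0 σ = 0 := fun σ h => by simp [hz0, h]
      refine ⟨joinv w z0, ?_, ?_⟩
      · intro σ hσ
        have h1 : w ∈ σ := by
          by_contra h; exact hσ (by simp [joinv, h])
        have h2 : z (σ.erase w) ≠ 0 := by simpa [joinv, h1, hz0] using hσ
        obtain ⟨hi, hs, hcard⟩ := hz _ h2
        have hsW : σ ⊆ W := by
          intro x hx
          by_cases hxw : x = w
          · exact hxw ▸ hw
          · exact hs (Finset.mem_erase.2 ⟨hxw, hx⟩)
        refine ⟨fun a ha b hb => he a (hsW ha) b (hsW hb), hsW, ?_⟩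
        rw [Finset.card_erase_of_mem h1] at hcard
        have := Finset.card_pos.2 ⟨w, h1⟩
        omega
      · obtain ⟨z1, hz1⟩ : ∃ z1 : Finset V → ZMod 2,
          z1 = fun τ => if w ∈ τ then 0 else z (insert w τ) := ⟨_, rfl⟩
        have hz1w : ∀ σ, w ∈ σ → z1 σ = 0 := fun σ h => by simp [hz1, h]
        have hsp : z = z0 + joinv w z1 := by
          funext σ
          by_cases h : w ∈ σ <;> simp [hz0, hz1, joinv, h, Finset.insert_erase]
        have hb0 := hbz
        rw [hsp, bdry_add, bdry_joinv w z1 hz1w] at hb0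
        have hbw : ∀ τ, w ∉ τ → bdry z0 τ = z1 τ := by
          intro τ h
          have := congrFun hb0 τ
          simp only [Pi.add_apply, joinv, h, if_false, add_zero, Pi.zero_apply] at this
          exact CharTwo.add_eq_zero.1 this
        rw [bdry_joinv w z0 hz0w, hsp]
        have : z0 + joinv w z1 = z := hsp.symm
        funext τ
        simp only [Pi.add_apply, joinv]
        rw [hbw _ (Finset.notMem_erase w τ)]

open Classical in
/-- The chain consisting of a single simplex. -/
noncomputable def sgl {V : Type*} (A : Finset V) : Finset V → ZMod 2 :=
  fun τ => if τ = A then 1 else 0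

theorem bdry_sgl_image {V ι : Type*} [Fintype V] [DecidableEq V] [DecidableEq ι] (s : ι → V)
    (hs : Function.Injective s) (I : Finset ι) :
    bdry (sgl (I.image s)) = ∑ i ∈ I, sgl ((I.erase i).image s) := by
  funext τ
  have h := bdry_adjoint (fun ρ => if ρ = τ then 1 else 0) (sgl (I.image s))
  simp only [sgl, ite_mul, one_mul, zero_mul, Finset.sum_ite_eq', Finset.mem_univ, if_true] at h
  rw [h, Finset.sum_image (fun a _ b _ hab => hs hab), Finset.sum_apply]
  apply Finset.sum_congr rfl
  intro i _
  rw [← Finset.image_erase hs]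
  simp only [sgl, eq_comm]
  congr

theorem exists_chains {V : Type*} [Fintype V] [DecidableEq V]
    (G : SimpleGraph V) (n : ℕ) (P : Fin n → Finset V)
    (hdom : ∀ I : Finset (Fin n), I.Nonempty →
      ∀ X ⊆ I.biUnion P, (∀ v ∈ I.biUnion P, ∃ u ∈ X, G.Adj u v) →
        2 * I.card + 1 ≤ X.card)
    (s t : Fin n → V) (hsi : Function.Injective s) (hti : Function.Injective t)
    (hsP : ∀ i, s i ∈ P i) (htP : ∀ i, t i ∈ P i)
    (hsG : ∀ i j, ¬ G.Adj (s i) (s j)) (htG : ∀ i j, ¬ G.Adj (t i) (t j)) (k : ℕ) :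
    ∃ c : Finset (Fin n) → Finset V → ZMod 2, ∀ I : Finset (Fin n), I.card < k →
      Supp G (I.biUnion P) (I.card + 1) (c I) ∧
      bdry (c I) = sgl (I.image s) + sgl (I.image t) + ∑ i ∈ I, c (I.erase i) := by
  classical
  induction k with
  | zero => exact ⟨fun _ => 0, fun I h => absurd h (by simp)⟩
  | succ k ih =>
    obtain ⟨c, hc⟩ := ih
    have step : ∀ I : Finset (Fin n), ∃ x : Finset V → ZMod 2, I.card = k →
        Supp G (I.biUnion P) (I.card + 1) x ∧
        bdry x = sgl (I.image s) + sgl (I.image t) + ∑ i ∈ I, c (I.erase i) := by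
      intro I
      by_cases hI : I.card = k
      swap
      · exact ⟨0, fun h => absurd h hI⟩
      rcases I.eq_empty_or_nonempty with rfl | hne
      · refine ⟨0, fun _ => ⟨fun σ h => absurd rfl h, ?_⟩⟩
        funext τ
        simp [bdry, zmod2_add_self]
      have hlt : ∀ i ∈ I, (I.erase i).card < k := by
        intro i hi
        rw [← hI]
        exact Finset.card_erase_lt_of_mem hi
      have hsg : ∀ r : Fin n → V, Function.Injective r → (∀ i, r i ∈ P i) →
          (∀ i j, ¬ G.Adj (r i) (r j)) → Supp G (I.biUnion P) I.card (sgl (I.image r)) := by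
        intro r hr hrP hrG σ hσ
        have : σ = I.image r := by
          by_contra h
          exact hσ (by simp [sgl, h])
        subst this
        refine ⟨?_, ?_, Finset.card_image_of_injective _ hr⟩
        · intro a ha b hb
          obtain ⟨i, -, rfl⟩ := Finset.mem_image.1 ha
          obtain ⟨j, -, rfl⟩ := Finset.mem_image.1 hb
          exact hrG i j
        · intro a ha
          obtain ⟨i, hi, rfl⟩ := Finset.mem_image.1 ha
          exact Finset.mem_biUnion.2 ⟨i, hi, hrP i⟩
      obtain ⟨x, hx⟩ := acyc I.card (I.biUnion P) G (hdom I hne)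
        (sgl (I.image s) + sgl (I.image t) + ∑ i ∈ I, c (I.erase i)) (by
          intro σ hσ
          by_cases h1 : sgl (I.image s) σ = 0
          · by_cases h2 : sgl (I.image t) σ = 0
            · have h3 : ∑ i ∈ I, c (I.erase i) σ ≠ 0 := by
                simpa [h1, h2, Finset.sum_apply] using hσ
              obtain ⟨i, hi, h4⟩ := Finset.exists_ne_zero_of_sum_ne_zero h3
              obtain ⟨a1, a2, a3⟩ := (hc _ (hlt i hi)).1 σ h4
              refine ⟨a1, a2.trans (Finset.biUnion_subset_biUnion_of_subset_left _
                (Finset.erase_subset _ _)), ?_⟩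
              rw [a3, Finset.card_erase_add_one hi]
            · exact hsg t hti htP htG σ h2
          · exact hsg s hsi hsP hsG σ h1) (by
          rw [bdry_add, bdry_add, bdry_sum, bdry_sgl_image s hsi, bdry_sgl_image t hti,
            Finset.sum_congr rfl (fun i hi => (hc _ (hlt i hi)).2), Finset.sum_add_distrib,
            Finset.sum_add_distrib]
          have hdbl : ∑ i ∈ I, ∑ j ∈ I.erase i, c ((I.erase i).erase j) = 0 := by
            rw [Finset.sum_sigma']
            refine Finset.sum_involution (fun p _ => ⟨p.2, p.1⟩) ?_ ?_ ?_ ?_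
            · rintro ⟨i, j⟩ _
              funext τ
              simp only [Pi.add_apply, Pi.zero_apply]
              rw [Finset.erase_right_comm]
              exact zmod2_add_self _
            · rintro ⟨i, j⟩ h _ heq
              simp only [Finset.mem_sigma, Finset.mem_erase] at h
              simp only [Sigma.mk.injEq] at heq
              exact h.2.1 heq.1
            · rintro ⟨i, j⟩ h
              simp only [Finset.mem_sigma, Finset.mem_erase] at h ⊢
              exact ⟨h.2.2, Ne.symm h.2.1, h.1⟩
            · rintro ⟨i, j⟩ h
              rfl
          rw [hdbl]
          funext τ
          simp only [Pi.add_apply, Pi.zero_apply, add_zero]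
          exact zmod2_add_self _)
      exact ⟨x, fun _ => hx⟩
    choose x hx using step
    refine ⟨fun I => if I.card < k then c I else x I, ?_⟩
    intro I hI
    have hsum : ∑ i ∈ I, (if (I.erase i).card < k then c (I.erase i) else x (I.erase i))
        = ∑ i ∈ I, c (I.erase i) := by
      apply Finset.sum_congr rfl
      intro i hi
      have := Finset.card_erase_lt_of_mem hi
      rw [if_pos (by omega)]
    simp only [hsum]
    by_cases h : I.card < k
    · simp only [h, if_true]
      exact hc I h
    · simp only [h, if_false]
      exact hx I (by omega)

theorem transversal_fun {V : Type*} [DecidableEq V]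
    (G : SimpleGraph V) (n : ℕ) (P : Fin n → Finset V)
    (hdisj : ∀ i j, i ≠ j → Disjoint (P i) (P j))
    (hcover : ∀ v, ∃ i, v ∈ P i)
    (S : Finset V) (hS : IsIndepTransversal G P S) :
    ∃ s : Fin n → V, Function.Injective s ∧ (∀ i, s i ∈ P i) ∧
      (∀ i j, ¬ G.Adj (s i) (s j)) ∧ Finset.univ.image s = S := by
  have h := fun i => Finset.card_eq_one.1 (hS.2 i)
  choose s hs using h
  have hm : ∀ i, s i ∈ S ∧ s i ∈ P i := fun i =>
    Finset.mem_inter.1 (by rw [hs i]; simp)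
  refine ⟨s, ?_, fun i => (hm i).2, fun i j => hS.1 _ (hm i).1 _ (hm j).1, ?_⟩
  · intro i j hij
    by_contra hne
    exact Finset.disjoint_left.1 (hdisj i j hne) (hm i).2 (hij ▸ (hm j).2)
  · ext x
    simp only [Finset.mem_image, Finset.mem_univ, true_and]
    constructor
    · rintro ⟨i, rfl⟩
      exact (hm i).1
    · intro hx
      obtain ⟨i, hi⟩ := hcover x
      have : x ∈ S ∩ P i := Finset.mem_inter.2 ⟨hx, hi⟩
      rw [hs i] at this
      exact ⟨i, (Finset.mem_singleton.1 this).symm⟩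

/-- If for every nonempty `I ⊆ [n]`, every set strongly dominating `V_I` in the induced
subgraph `G[V_I]` has size at least `2|I| + 1`, then the reconfiguration graph on
independent transversals is connected. -/
theorem stmt_7 {V : Type*} [Fintype V] [DecidableEq V]
    (G : SimpleGraph V) (n : ℕ)
    (P : Fin n → Finset V)
    (hne : ∀ i, (P i).Nonempty)
    (hdisj : ∀ i j, i ≠ j → Disjoint (P i) (P j))
    (hcover : ∀ v, ∃ i, v ∈ P i)
    (hdom : ∀ I : Finset (Fin n), I.Nonempty →
      ∀ X ⊆ I.biUnion P, (∀ v ∈ I.biUnion P, ∃ u ∈ X, G.Adj u v) →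
        2 * I.card + 1 ≤ X.card)
    (S T : Finset V)
    (hS : IsIndepTransversal G P S) (hT : IsIndepTransversal G P T) :
    Relation.ReflTransGen (ITAdj G P) S T := by
  classical
  obtain ⟨s, hsi, hsP, hsG, hsS⟩ := transversal_fun G n P hdisj hcover S hS
  obtain ⟨t, hti, htP, htG, htT⟩ := transversal_fun G n P hdisj hcover T hT
  obtain ⟨c, hc⟩ := exists_chains G n P hdom s t hsi hti hsP htP hsG htG (n + 1)
  obtain ⟨hsupp, hbd⟩ := hc Finset.univ (by simp)
  rw [hsS, htT] at hbd
  simp only [Finset.card_univ, Fintype.card_fin] at hsupp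
  obtain ⟨F, hF⟩ : ∃ F : Finset V → ZMod 2,
    F = fun τ => if Relation.ReflTransGen (ITAdj G P) S τ then 1 else 0 := ⟨_, rfl⟩
  have hreachIT : ∀ τ, Relation.ReflTransGen (ITAdj G P) S τ → IsIndepTransversal G P τ := by
    intro τ h
    cases h with
    | refl => exact hS
    | tail _ h => exact h.2.1
  have hF0 : ∀ τ, F τ ≠ 0 → Relation.ReflTransGen (ITAdj G P) S τ := by
    intro τ h
    by_contra h'
    exact h (by simp [hF, h'])
  have h0 : ∑ σ, c Finset.univ σ * ∑ x ∈ σ, F (σ.erase x) = 0 := by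
    apply Finset.sum_eq_zero
    intro σ _
    by_cases hcσ : c Finset.univ σ = 0
    · simp [hcσ]
    obtain ⟨hind, -, hcard⟩ := hsupp σ hcσ
    rw [mul_eq_zero]
    right
    by_cases hall : ∀ x ∈ σ, F (σ.erase x) = 0
    · exact Finset.sum_eq_zero hall
    push Not at hall
    obtain ⟨x, hx, hFx⟩ := hall
    have hR := hF0 _ hFx
    have hIT := hreachIT _ hR
    obtain ⟨i, hi⟩ := hcover x
    obtain ⟨y, hy⟩ := Finset.card_eq_one.1 (hIT.2 i)
    have hy' : y ∈ σ.erase x ∩ P i := by rw [hy]; simp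
    simp only [Finset.mem_inter, Finset.mem_erase] at hy'
    obtain ⟨⟨hyx, hyσ⟩, hyi⟩ := hy'
    have hσi : σ ∩ P i = {x, y} := by
      ext a
      have := Finset.ext_iff.1 hy a
      simp only [Finset.mem_inter, Finset.mem_erase, Finset.mem_singleton, Finset.mem_insert] at this ⊢
      constructor
      · rintro ⟨h1, h2⟩
        by_cases hax : a = x
        · exact Or.inl hax
        · exact Or.inr (this.1 ⟨⟨hax, h1⟩, h2⟩)
      · rintro (rfl | rfl)
        · exact ⟨hx, hi⟩
        · exact ⟨hyσ, hyi⟩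
    have hITy : IsIndepTransversal G P (σ.erase y) := by
      refine ⟨fun a ha b hb => hind a (Finset.mem_of_mem_erase ha) b (Finset.mem_of_mem_erase hb), ?_⟩
      intro j
      by_cases hj : j = i
      · subst hj
        rw [Finset.erase_inter, hσi, Finset.card_erase_of_mem (by simp), Finset.card_pair hyx.symm]
      · have h1 : x ∉ P j := fun h => Finset.disjoint_left.1 (hdisj j i hj) h hi
        have h2 : y ∉ P j := fun h => Finset.disjoint_left.1 (hdisj j i hj) h hyi
        have h3 := hIT.2 j
        rw [Finset.erase_inter, Finset.erase_eq_of_notMem (by simp [h1])] at h3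
        rw [Finset.erase_inter, Finset.erase_eq_of_notMem (by simp [h2]), h3]
    have hun : σ.erase x ∪ σ.erase y = σ := by
      ext a
      simp only [Finset.mem_union, Finset.mem_erase]
      constructor
      · rintro (h | h) <;> exact h.2
      · intro h
        by_cases hax : a = x
        · exact Or.inr ⟨hax ▸ hyx.symm, h⟩
        · exact Or.inl ⟨hax, h⟩
    have hadj : ITAdj G P (σ.erase x) (σ.erase y) := by
      refine ⟨hIT, hITy, ?_, ?_⟩
      · rw [hun]; exact hind
      · rw [hun]; exact hcard
    have hRy := hR.tail hadj
    rw [← Finset.sum_subset (s₁ := {x, y}) (by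
      intro a ha
      simp only [Finset.mem_insert, Finset.mem_singleton] at ha
      rcases ha with rfl | rfl
      · exact hx
      · exact hyσ) (by
      intro a ha hna
      by_contra hne0
      have h1 := (hreachIT _ (hF0 _ hne0)).2 i
      rw [Finset.erase_inter, hσi, Finset.erase_eq_of_notMem hna, Finset.card_pair hyx.symm] at h1
      omega)]
    rw [Finset.sum_pair hyx.symm]
    simp only [hF, hR, hRy, if_true]
    exact zmod2_add_self 1
  rw [← bdry_adjoint, hbd] at h0
  have hsgl : ∀ A : Finset V, ∑ τ, F τ * sgl A τ = F A := by
    intro A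
    simp [sgl]
  have hz : ∑ τ, F τ * (∑ i, c (Finset.univ.erase i)) τ = 0 := by
    apply Finset.sum_eq_zero
    intro τ _
    by_cases hFτ : F τ = 0
    · simp [hFτ]
    rw [mul_eq_zero]
    right
    rw [Finset.sum_apply]
    apply Finset.sum_eq_zero
    intro i _
    by_contra hne0
    have hsub := ((hc (Finset.univ.erase i) (by
      have := Finset.card_erase_lt_of_mem (Finset.mem_univ i)
      simp only [Finset.card_univ, Fintype.card_fin] at this
      omega)).1 τ hne0).2.1
    obtain ⟨y, hy⟩ := Finset.card_eq_one.1 ((hreachIT _ (hF0 _ hFτ)).2 i)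
    have hy' : y ∈ τ ∩ P i := by rw [hy]; simp
    obtain ⟨h1, h2⟩ := Finset.mem_inter.1 hy'
    obtain ⟨j, hj, hyj⟩ := Finset.mem_biUnion.1 (hsub h1)
    exact Finset.disjoint_left.1 (hdisj j i (Finset.ne_of_mem_erase hj)) hyj h2
  simp only [Pi.add_apply, mul_add, Finset.sum_add_distrib, hsgl, hz, add_zero] at h0
  apply hF0
  intro hT0
  rw [hT0, add_zero] at h0
  simp [hF, Relation.ReflTransGen.refl] at h0
end

section
/- Let G be a finite simple graph and let 𝒱 = {V_1, …, V_n} be a partition of V(G). If for every nonempty subset I ⊆ {1,…,n} there exists an independent set S of the induced subgraph G[V_I] such that every set X ⊆ V_I that strongly dominates S in G[V_I] satisfies |X| ≥ |I| + 1, then the reconfiguration graph RG(G, 𝒱) is connected. -/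
namespace ITR

open Finset

variable {V : Type*} [Fintype V] [DecidableEq V]

/-- Mod 2 boundary. -/
def bd (c : Finset V → ZMod 2) (B : Finset V) : ZMod 2 :=
  ∑ v, if v ∈ B then 0 else c (insert v B)

/-- The cone with apex `v`. -/
def cone (v : V) (w : Finset V → ZMod 2) (A : Finset V) : ZMod 2 :=
  if v ∈ A then w (A.erase v) else 0

/-- Indicator of a set. -/
def ind (A : Finset V) (B : Finset V) : ZMod 2 := if B = A then 1 else 0

lemma bd_add (c d : Finset V → ZMod 2) : bd (c + d) = bd c + bd d := by
  funext B
  simp only [bd, Pi.add_apply, ← Finset.sum_add_distrib]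
  refine Finset.sum_congr rfl fun v _ => ?_
  split_ifs <;> simp

lemma bd_zero : bd (0 : Finset V → ZMod 2) = 0 := by
  funext B
  simp [bd]

lemma bd_sum {ι : Type*} (s : Finset ι) (f : ι → Finset V → ZMod 2) :
    bd (∑ i ∈ s, f i) = ∑ i ∈ s, bd (f i) := by
  classical
  induction s using Finset.induction_on with
  | empty => simp [bd_zero]
  | insert a s ha ih => rw [Finset.sum_insert ha, Finset.sum_insert ha, bd_add, ih]

lemma add_self (c : Finset V → ZMod 2) : c + c = 0 := by
  funext B
  exact CharTwo.add_self_eq_zero _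

lemma bd_ind (A : Finset V) : bd (ind A) = ∑ a ∈ A, ind (A.erase a) := by
  funext B
  have h1 : ∑ a ∈ A, ind (A.erase a) B = ∑ a, if a ∈ A then ind (A.erase a) B else 0 := by
    simp
  rw [Finset.sum_apply, h1, bd]
  refine Finset.sum_congr rfl fun v _ => ?_
  have h2 : (v ∉ B ∧ insert v B = A) ↔ (v ∈ A ∧ B = A.erase v) := by
    constructor
    · rintro ⟨h, rfl⟩
      simp [h]
    · rintro ⟨h, rfl⟩
      simp [h]
  by_cases hB : v ∈ B <;> by_cases hA : v ∈ A <;> simp only [hB, hA, ind, if_true, if_false]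
  · rw [if_neg]
    rintro rfl
    simp at hB
  · simp only [hB, hA, not_false_eq_true, true_and] at h2
    simp only [h2]
  · rw [if_neg]
    rintro rfl
    simp at hA

lemma bd_cone (v : V) (w : Finset V → ZMod 2) (hw : ∀ A, v ∈ A → w A = 0) :
    bd (cone v w) = w + cone v (bd w) := by
  funext B
  simp only [Pi.add_apply]
  by_cases hv : v ∈ B
  · rw [hw B hv, zero_add, cone, if_pos hv, bd, bd]
    refine Finset.sum_congr rfl fun u _ => ?_
    by_cases huv : u = v
    · subst huv
      simp [hv, hw]
    · by_cases hu : u ∈ B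
      · simp [hu, huv]
      · have : (insert u B).erase v = insert u (B.erase v) := by
          rw [Finset.erase_insert_of_ne huv]
        simp [hu, cone, hv, this]
  · rw [cone, if_neg hv, add_zero, bd, Finset.sum_eq_single v]
    · simp [hv, cone]
    · intro u _ huv
      split_ifs with h
      · rfl
      · rw [cone, if_neg]
        simp [hv, Ne.symm huv]
    · simp

/-- part of a chain away from `v` -/
def dl (v : V) (z : Finset V → ZMod 2) (A : Finset V) : ZMod 2 := if v ∈ A then 0 else z A
/-- link part of a chain at `v` -/
def lk (v : V) (z : Finset V → ZMod 2) (A : Finset V) : ZMod 2 :=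
  if v ∈ A then 0 else z (insert v A)

lemma split (v : V) (z : Finset V → ZMod 2) : z = dl v z + cone v (lk v z) := by
  funext A
  by_cases h : v ∈ A <;> simp [dl, lk, cone, h]

lemma bd_avoid (v : V) (w : Finset V → ZMod 2) (hw : ∀ A, v ∈ A → w A = 0) (A : Finset V)
    (h : v ∈ A) : bd w A = 0 := by
  refine Finset.sum_eq_zero fun x hx => ?_
  split_ifs
  · rfl
  · exact hw _ (by simp [h])

lemma cyc (v : V) (z : Finset V → ZMod 2) (hz : bd z = 0) :
    bd (dl v z) = lk v z ∧ bd (lk v z) = 0 := by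
  have h0 : ∀ A, v ∈ A → dl v z A = 0 := fun A h => by simp [dl, h]
  have h1 : ∀ A, v ∈ A → lk v z A = 0 := fun A h => by simp [lk, h]
  have h := hz
  rw [split v z, bd_add, bd_cone v _ h1] at h
  constructor
  · funext B
    by_cases hB : v ∈ B
    · rw [bd_avoid v _ h0 B hB, h1 B hB]
    · have := congrFun h B
      simp only [Pi.add_apply, cone, if_neg hB, add_zero, Pi.zero_apply] at this
      exact CharTwo.add_eq_zero.mp this
  · funext B
    by_cases hB : v ∈ B
    · rw [bd_avoid v _ h1 B hB]; rfl
    · have := congrFun h (insert v B)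
      have hm : v ∈ insert v B := by simp
      simpa [bd_avoid v _ h0 _ hm, h1 _ hm, cone, hB] using this

/-- supported on independent `m`-sets in `W` -/
def Supp (G : SimpleGraph V) (W : Finset V) (m : ℕ) (c : Finset V → ZMod 2) : Prop :=
  ∀ A, c A ≠ 0 → IndepSet G A ∧ A ⊆ W ∧ A.card = m

lemma Supp.add {G : SimpleGraph V} {W : Finset V} {m : ℕ} {c d : Finset V → ZMod 2}
    (hc : Supp G W m c) (hd : Supp G W m d) : Supp G W m (c + d) := by
  intro A hA
  by_cases h : c A = 0
  · exact hd A (by simpa [h] using hA)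
  · exact hc A h

lemma Supp.mono {G : SimpleGraph V} {W W' : Finset V} {m : ℕ} {c : Finset V → ZMod 2}
    (hc : Supp G W m c) (h : W ⊆ W') : Supp G W' m c :=
  fun A hA => ⟨(hc A hA).1, (hc A hA).2.1.trans h, (hc A hA).2.2⟩

lemma Supp.cone {G : SimpleGraph V} {W W' : Finset V} {m : ℕ} {w : Finset V → ZMod 2} {v : V}
    (hv : v ∈ W) (hw : Supp G W' m w) (hW : W' ⊆ W)
    (hn : ∀ u ∈ W', ¬ G.Adj v u) (hav : ∀ A, v ∈ A → w A = 0) : Supp G W (m + 1) (cone v w) := by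
  intro A hA
  have hvA : v ∈ A := by
    by_contra h
    simp [ITR.cone, h] at hA
  simp only [ITR.cone, if_pos hvA] at hA
  obtain ⟨h1, h2, h3⟩ := hw _ hA
  obtain ⟨B, hvB, rfl⟩ : ∃ B, v ∉ B ∧ insert v B = A :=
    ⟨A.erase v, by simp, Finset.insert_erase hvA⟩
  rw [Finset.erase_insert hvB] at *
  refine ⟨?_, ?_, ?_⟩
  · intro x hx y hy
    rw [Finset.mem_insert] at hx hy
    rcases hx with rfl | hx <;> rcases hy with rfl | hy
    · exact G.loopless.irrefl _
    · exact hn _ (h2 hy)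
    · exact fun h => hn _ (h2 hx) h.symm
    · exact h1 _ hx _ hy
  · exact Finset.insert_subset hv (h2.trans hW)
  · rw [Finset.card_insert_of_notMem hvB, h3]

lemma acyclic (G : SimpleGraph V) : ∀ (k : ℕ) (W : Finset V), W.card ≤ k → ∀ (m : ℕ)
    (S : Finset V), S ⊆ W → IndepSet G S →
    (∀ X ⊆ W, (∀ v ∈ S, ∃ u ∈ X, G.Adj u v) → m + 1 ≤ X.card) →
    ∀ z, Supp G W m z → bd z = 0 → ∃ c, Supp G W (m + 1) c ∧ bd c = z := by
  classical
  intro k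
  induction k with
  | zero =>
    intro W hW m S hS hI hX z
    have hW : W = ∅ := by simpa using hW
    subst hW
    have hS : S = ∅ := by simpa using hS
    subst hS
    have := hX ∅ (by simp) (by simp)
    simp at this
  | succ k ih =>
    intro W hW m S hS hI hX z hz hbz
    by_cases hSe : S = ∅
    · subst hSe
      have := hX ∅ (by simp) (by simp)
      simp at this
    obtain ⟨s, hs⟩ := Finset.nonempty_iff_ne_empty.mpr hSe
    have hdl : ∀ v, Supp G (W.erase v) m (dl v z) := by
      intro v A hA
      have hv : v ∉ A := by
        intro h
        simp [dl, h] at hA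
      simp only [dl, if_neg hv] at hA
      obtain ⟨h1, h2, h3⟩ := hz A hA
      exact ⟨h1, Finset.subset_erase.mpr ⟨h2, hv⟩, h3⟩
    have hd0 : ∀ v A, v ∈ A → dl v z A = 0 := fun v A h => by simp [dl, h]
    have hl0 : ∀ v A, v ∈ A → lk v z A = 0 := fun v A h => by simp [lk, h]
    by_cases hiso : ∀ u ∈ W, ¬ G.Adj s u
    · refine ⟨cone s (dl s z), ?_, ?_⟩
      · exact Supp.cone (hS hs) ((hdl s)) (Finset.erase_subset _ _)
          (fun u hu => hiso u (Finset.mem_of_mem_erase hu)) (hd0 s)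
      · rw [bd_cone s _ (hd0 s), (cyc s z hbz).1, ← split]
    · push Not at hiso
      obtain ⟨v, hv, hsv⟩ := hiso
      have hvS : v ∉ S := fun h => hI _ hs _ h hsv
      have hcard : (W.erase v).card ≤ k := by
        rw [Finset.card_erase_of_mem hv]; omega
      -- the filling of the link
      obtain ⟨w, hw, hbw⟩ : ∃ w, Supp G ((W.erase v).filter (fun u => ¬ G.Adj v u)) m w ∧
          bd w = lk v z := by
        set W' := (W.erase v).filter (fun u => ¬ G.Adj v u) with hW'
        have hlk : ∀ A, lk v z A ≠ 0 → IndepSet G A ∧ A ⊆ W' ∧ A.card + 1 = m := by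
          intro A hA
          have hvA : v ∉ A := by
            intro h
            simp [lk, h] at hA
          simp only [lk, if_neg hvA] at hA
          obtain ⟨h1, h2, h3⟩ := hz _ hA
          refine ⟨fun x hx y hy => h1 x (by simp [hx]) y (by simp [hy]), ?_, ?_⟩
          · intro x hx
            simp only [hW', mem_filter, mem_erase]
            refine ⟨⟨?_, h2 (by simp [hx])⟩, h1 _ (by simp) _ (by simp [hx])⟩
            rintro rfl
            exact hvA hx
          · rw [← h3, Finset.card_insert_of_notMem hvA]
        rcases m with _ | m
        · have : lk v z = 0 := by
            funext A
            by_contra h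
            have := (hlk A h).2.2
            omega
          refine ⟨0, ?_, ?_⟩
          · intro A hA
            simp at hA
          · rw [this, bd_zero]
        · refine ih W' ((Finset.card_le_card (Finset.filter_subset _ _)).trans hcard) m
            (S.filter (fun u => ¬ G.Adj v u)) ?_ ?_ ?_ (lk v z) ?_ (cyc v z hbz).2
          · intro x hx
            simp only [mem_filter] at hx
            simp only [hW', mem_filter, mem_erase]
            refine ⟨⟨?_, hS hx.1⟩, hx.2⟩
            rintro rfl
            exact hvS hx.1
          · intro x hx y hy
            exact hI x (Finset.mem_of_mem_filter _ hx) y (Finset.mem_of_mem_filter _ hy)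
          · intro X hXW hdomX
            have := hX (insert v X) ?_ ?_
            · have h2 := Finset.card_insert_le v X
              omega
            · refine Finset.insert_subset hv (hXW.trans ?_)
              exact (Finset.filter_subset _ _).trans (Finset.erase_subset _ _)
            · intro x hx
              by_cases hvx : G.Adj v x
              · exact ⟨v, by simp, hvx⟩
              · obtain ⟨u, hu, hux⟩ := hdomX x (by simp [hx, hvx])
                exact ⟨u, by simp [hu], hux⟩
          · intro A hA
            obtain ⟨h1, h2, h3⟩ := hlk A hA
            exact ⟨h1, h2, by omega⟩
      have hw0 : ∀ A, v ∈ A → w A = 0 := by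
        intro A hvA
        by_contra h
        have := (hw A h).2.1 hvA
        simp at this
      have hsuppc : Supp G W (m + 1) (cone v w) := by
        refine Supp.cone hv hw ((Finset.filter_subset _ _).trans (Finset.erase_subset _ _)) ?_ hw0
        intro u hu
        exact (Finset.mem_filter.mp hu).2
      have hbc : bd (cone v w) = w + cone v (lk v z) := by rw [bd_cone v w hw0, hbw]
      obtain ⟨c, hc, hbdc⟩ := ih (W.erase v) hcard m S (Finset.subset_erase.mpr ⟨hS, hvS⟩) hI
        (fun X hXW => hX X (hXW.trans (Finset.erase_subset _ _))) (dl v z + w)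
        ((hdl v).add (hw.mono (Finset.filter_subset _ _)))
        (by rw [bd_add, hbw, (cyc v z hbz).1, add_self])
      refine ⟨c + cone v w, (hc.mono (Finset.erase_subset _ _)).add hsuppc, ?_⟩
      rw [bd_add, hbdc, hbc]
      conv_rhs => rw [split v z]
      calc dl v z + w + (w + cone v (lk v z)) = dl v z + cone v (lk v z) + (w + w) := by abel
        _ = _ := by rw [add_self, add_zero]

lemma dsum_zero {n : ℕ} (c : Finset (Fin n) → Finset V → ZMod 2) (I : Finset (Fin n)) :
    ∑ i ∈ I, ∑ j ∈ I.erase i, c ((I.erase i).erase j) = 0 := by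
  rw [Finset.sum_sigma']
  refine Finset.sum_involution (fun a _ => ⟨a.2, a.1⟩) ?_ ?_ ?_ ?_
  · rintro ⟨i, j⟩ h
    simp only
    rw [Finset.erase_right_comm, add_self]
  · rintro ⟨i, j⟩ h _ h2
    simp at h h2
    exact h.2.1 h2.1
  · rintro ⟨i, j⟩ h
    simp at h ⊢
    exact ⟨h.2.2, Ne.symm h.2.1, h.1⟩
  · rintro ⟨i, j⟩ h
    rfl

lemma bd_ind_image {n : ℕ} (s : Fin n → V) (hs : Function.Injective s) (I : Finset (Fin n)) :
    bd (ind (I.image s)) = ∑ i ∈ I, ind ((I.erase i).image s) := by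
  rw [bd_ind, Finset.sum_image (fun x _ y _ h => hs h)]
  refine Finset.sum_congr rfl fun i _ => ?_
  rw [Finset.image_erase hs]

lemma ind_supp (G : SimpleGraph V) {n : ℕ} (P : Fin n → Finset V) (s : Fin n → V)
    (hs : Function.Injective s) (hP : ∀ i, s i ∈ P i) (hind : ∀ i j, ¬ G.Adj (s i) (s j))
    (I : Finset (Fin n)) : Supp G (I.biUnion P) I.card (ind (I.image s)) := by
  intro A hA
  have : A = I.image s := by
    by_contra h
    simp [ind, h] at hA
  subst this
  refine ⟨?_, ?_, Finset.card_image_of_injective _ hs⟩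
  · intro u hu v hv
    simp only [mem_image] at hu hv
    obtain ⟨i, _, rfl⟩ := hu
    obtain ⟨j, _, rfl⟩ := hv
    exact hind i j
  · intro u hu
    simp only [mem_image] at hu
    obtain ⟨i, hi, rfl⟩ := hu
    exact Finset.mem_biUnion.mpr ⟨i, hi, hP i⟩

lemma sum_supp {G : SimpleGraph V} {W : Finset V} {m : ℕ} {ι : Type*} (s : Finset ι)
    (f : ι → Finset V → ZMod 2) (h : ∀ i ∈ s, Supp G W m (f i)) :
    Supp G W m (∑ i ∈ s, f i) := by
  intro A hA
  rw [Finset.sum_apply] at hA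
  obtain ⟨i, hi, hne⟩ := Finset.exists_ne_zero_of_sum_ne_zero hA
  exact h i hi A hne

lemma chains (G : SimpleGraph V) {n : ℕ} (P : Fin n → Finset V)
    (hdom : ∀ I : Finset (Fin n), I.Nonempty →
      ∃ S ⊆ I.biUnion P, IndepSet G S ∧
        ∀ X ⊆ I.biUnion P, (∀ v ∈ S, ∃ u ∈ X, G.Adj u v) →
          I.card + 1 ≤ X.card)
    (s t : Fin n → V)
    (hs : Function.Injective s) (hPs : ∀ i, s i ∈ P i) (hinds : ∀ i j, ¬ G.Adj (s i) (s j))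
    (ht : Function.Injective t) (hPt : ∀ i, t i ∈ P i) (hindt : ∀ i j, ¬ G.Adj (t i) (t j))
    (k : ℕ) : ∃ c : Finset (Fin n) → Finset V → ZMod 2, ∀ I, I.card ≤ k →
      Supp G (I.biUnion P) (I.card + 1) (c I) ∧
      bd (c I) = ind (I.image s) + ind (I.image t) + ∑ i ∈ I, c (I.erase i) := by
  classical
  induction k with
  | zero =>
    refine ⟨0, fun I hI => ?_⟩
    have : I = ∅ := by simpa using hI
    subst this
    refine ⟨fun A hA => by simp at hA, ?_⟩
    simp [bd_zero, add_self]
  | succ k ih =>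
    obtain ⟨c, hc⟩ := ih
    have key : ∀ I : Finset (Fin n), I.card = k + 1 → ∃ d,
        Supp G (I.biUnion P) (I.card + 1) d ∧
        bd d = ind (I.image s) + ind (I.image t) + ∑ i ∈ I, c (I.erase i) := by
      intro I hI
      have hle : ∀ i ∈ I, (I.erase i).card ≤ k := fun i hi => by
        rw [Finset.card_erase_of_mem hi]; omega
      obtain ⟨S, h1, h2, h3⟩ := hdom I (Finset.card_pos.mp (by omega))
      refine acyclic G _ (I.biUnion P) le_rfl I.card S h1 h2 h3 _ ?_ ?_
      · refine ((ind_supp G P s hs hPs hinds I).add (ind_supp G P t ht hPt hindt I)).add ?_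
        refine sum_supp _ _ fun i hi => ?_
        have := (hc _ (hle i hi)).1
        rw [Finset.card_erase_add_one hi] at this
        exact this.mono (Finset.biUnion_subset_biUnion_of_subset_left _ (Finset.erase_subset _ _))
      · rw [bd_add, bd_add, bd_sum, bd_ind_image s hs, bd_ind_image t ht,
          Finset.sum_congr rfl (fun i hi => (hc _ (hle i hi)).2), Finset.sum_add_distrib,
          Finset.sum_add_distrib, dsum_zero, add_zero, add_self]
    choose! d hd using key
    refine ⟨fun I => if I.card ≤ k then c I else d I, fun I hI => ?_⟩
    have hsum : ∑ i ∈ I, (if (I.erase i).card ≤ k then c (I.erase i) else d (I.erase i))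
        = ∑ i ∈ I, c (I.erase i) := by
      refine Finset.sum_congr rfl fun i hi => ?_
      rw [if_pos]
      rw [Finset.card_erase_of_mem hi]; omega
    simp only [hsum]
    by_cases h : I.card ≤ k
    · simpa only [if_pos h] using hc I h
    · simp only [if_neg h]
      exact hd I (by omega)

lemma IT_rep {G : SimpleGraph V} {n : ℕ} {P : Fin n → Finset V}
    (hdisj : ∀ i j, i ≠ j → Disjoint (P i) (P j))
    (hcover : ∀ v, ∃ i, v ∈ P i) {S : Finset V} (hS : IsIndepTransversal G P S) :
    ∃ s : Fin n → V, Function.Injective s ∧ (∀ i, s i ∈ P i) ∧ univ.image s = S ∧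
      (∀ i x, x ∈ S → x ∈ P i → x = s i) := by
  have h : ∀ i, ∃ a, S ∩ P i = {a} := fun i => Finset.card_eq_one.mp (hS.2 i)
  choose s hs using h
  have hm : ∀ i, s i ∈ S ∧ s i ∈ P i := fun i => by
    have : s i ∈ S ∩ P i := by rw [hs i]; simp
    simpa using this
  have hu : ∀ i x, x ∈ S → x ∈ P i → x = s i := fun i x h1 h2 => by
    have : x ∈ S ∩ P i := by simp [h1, h2]
    rw [hs i] at this
    simpa using this
  refine ⟨s, ?_, fun i => (hm i).2, ?_, hu⟩
  · intro i j hij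
    by_contra hne
    refine Finset.disjoint_left.mp (hdisj i j hne) (hm i).2 ?_
    rw [hij]; exact (hm j).2
  · ext x
    simp only [mem_image, mem_univ, true_and]
    constructor
    · rintro ⟨i, rfl⟩
      exact (hm i).1
    · intro hx
      obtain ⟨i, hi⟩ := hcover x
      exact ⟨i, (hu i x hx hi).symm⟩

/-- swapping in a vertex `v` -/
lemma swap {G : SimpleGraph V} {n : ℕ} {P : Fin n → Finset V}
    (hdisj : ∀ i j, i ≠ j → Disjoint (P i) (P j))
    (hcover : ∀ v, ∃ i, v ∈ P i) {B : Finset V} (hB : IsIndepTransversal G P B) {v u : V} {i : Fin n}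
    (hv : v ∉ B) (hvi : v ∈ P i) (hu : u ∈ B) (hui : u ∈ P i) (hI : IndepSet G (insert v B)) :
    ITAdj G P B ((insert v B).erase u) := by
  obtain ⟨s, hsi, hsP, hsS, hsu⟩ := IT_rep hdisj hcover hB
  have hun : B ∪ (insert v B).erase u = insert v B := by
    ext x
    simp only [mem_union, mem_erase, mem_insert]
    constructor
    · tauto
    · rintro (rfl | h)
      · refine Or.inr ⟨?_, Or.inl rfl⟩
        rintro rfl
        exact hv hu
      · exact Or.inl h
  refine ⟨hB, ⟨fun x hx y hy => hI x (Finset.mem_of_mem_erase hx) y (Finset.mem_of_mem_erase hy),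
    ?_⟩, by rwa [hun], ?_⟩
  · intro j
    have huv : v ≠ u := by
      rintro rfl
      exact hv hu
    by_cases hj : j = i
    · subst hj
      rw [Finset.card_eq_one]
      refine ⟨v, ?_⟩
      ext x
      simp only [mem_inter, mem_erase, mem_insert, mem_singleton]
      constructor
      · rintro ⟨⟨h1, h2 | h2⟩, h3⟩
        · exact h2
        · exact absurd ((hsu j x h2 h3).trans (hsu j u hu hui).symm) h1
      · rintro rfl
        exact ⟨⟨huv, Or.inl rfl⟩, hvi⟩
    · rw [← hB.2 j]
      congr 1
      ext x
      simp only [mem_inter, mem_erase, mem_insert]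
      constructor
      · rintro ⟨⟨h1, h2 | h2⟩, h3⟩
        · subst h2
          exact absurd hvi (Finset.disjoint_left.mp (hdisj j i hj) h3)
        · exact ⟨h2, h3⟩
      · rintro ⟨h1, h2⟩
        refine ⟨⟨?_, Or.inr h1⟩, h2⟩
        rintro rfl
        exact absurd hui (Finset.disjoint_left.mp (hdisj j i hj) h2)
  · rw [hun, Finset.card_insert_of_notMem hv, ← hsS, Finset.card_image_of_injective _ hsi]
    simp

end ITR

open Finset ITR in
/-- If for every nonempty `I ⊆ [n]` there is an independent set `S` of the induced
subgraph `G[V_I]` such that every set strongly dominating `S` in `G[V_I]` has size at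
least `|I| + 1`, then the reconfiguration graph on independent transversals is
connected. -/
theorem stmt_8 {V : Type*} [Fintype V] [DecidableEq V]
    (G : SimpleGraph V) (n : ℕ)
    (P : Fin n → Finset V)
    (hne : ∀ i, (P i).Nonempty)
    (hdisj : ∀ i j, i ≠ j → Disjoint (P i) (P j))
    (hcover : ∀ v, ∃ i, v ∈ P i)
    (hdom : ∀ I : Finset (Fin n), I.Nonempty →
      ∃ S ⊆ I.biUnion P, IndepSet G S ∧
        ∀ X ⊆ I.biUnion P, (∀ v ∈ S, ∃ u ∈ X, G.Adj u v) →
          I.card + 1 ≤ X.card)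
    (S T : Finset V)
    (hS : IsIndepTransversal G P S) (hT : IsIndepTransversal G P T) :
    Relation.ReflTransGen (ITAdj G P) S T := by
  classical
  obtain ⟨s, hsi, hsP, hsS, hsu⟩ := IT_rep hdisj hcover hS
  obtain ⟨t, hti, htP, htT, htu⟩ := IT_rep hdisj hcover hT
  have hms : ∀ i, s i ∈ S := fun i => by rw [← hsS]; simp
  have hmt : ∀ i, t i ∈ T := fun i => by rw [← htT]; simp
  obtain ⟨c, hc⟩ := chains G P hdom s t hsi hsP (fun i j => hS.1 _ (hms i) _ (hms j))
    hti htP (fun i j => hT.1 _ (hmt i) _ (hmt j)) n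
  by_contra hST
  set R := Relation.ReflTransGen (ITAdj G P) S with hR
  have hRIT : ∀ B, R B → IsIndepTransversal G P B := by
    intro B hB
    rcases Relation.ReflTransGen.cases_tail hB with h | ⟨D, _, h⟩
    · rw [h]; exact hS
    · exact h.2.1
  obtain ⟨hsup, hbd⟩ := hc univ (by simp)
  have hbdB : ∀ B, R B → bd (c univ) B = if B = S then 1 else 0 := by
    intro B hB
    rw [hbd, hsS, htT]
    simp only [Pi.add_apply, Finset.sum_apply, ind]
    have hBT : B ≠ T := by
      rintro rfl
      exact hST hB
    rw [if_neg hBT, add_zero, Finset.sum_eq_zero, add_zero]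
    intro i _
    by_contra h
    have h2 := ((hc (univ.erase i) (by
      simpa using Finset.card_le_univ ((univ : Finset (Fin n)).erase i))).1 B h).2.1
    obtain ⟨b, _, hbP, hbB, _⟩ := IT_rep hdisj hcover (hRIT B hB)
    have h3 : b i ∈ B := by rw [← hbB]; simp
    have h4 := h2 h3
    simp only [mem_biUnion, mem_erase, mem_univ, and_true] at h4
    obtain ⟨j, hj, hbj⟩ := h4
    exact Finset.disjoint_left.mp (hdisj j i hj) hbj (hbP i)
  have hsum1 : ∑ B with R B, bd (c univ) B = 1 := by
    rw [Finset.sum_congr rfl (fun B hB => hbdB B (Finset.mem_filter.mp hB).2)]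
    rw [Finset.sum_ite_eq' ]
    rw [if_pos]
    simp only [mem_filter, mem_univ, true_and]
    exact Relation.ReflTransGen.refl
  have hsum0 : ∑ B with R B, bd (c univ) B = 0 := by
    have hrew : ∑ B with R B, bd (c univ) B =
        ∑ p : Finset V × V with (R p.1 ∧ p.2 ∉ p.1 ∧ IndepSet G (insert p.2 p.1)),
          c univ (insert p.2 p.1) := by
      rw [Finset.sum_filter, Finset.sum_filter, Fintype.sum_prod_type]
      refine Finset.sum_congr rfl fun B _ => ?_
      by_cases hB : R B
      · simp only [hB, if_true, true_and, bd]
        refine Finset.sum_congr rfl fun v _ => ?_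
        by_cases hv : v ∈ B
        · simp [hv]
        · by_cases hI : IndepSet G (insert v B)
          · simp [hv, hI]
          · simp only [hv, hI, if_false, not_false_eq_true, and_false]
            by_contra h
            exact hI (hsup _ h).1
      · simp [hB]
    rw [hrew]
    have hex : ∀ p : Finset V × V, ∃ u i, R p.1 → (u ∈ p.1 ∧ u ∈ P i ∧ p.2 ∈ P i ∧
        ∀ x, x ∈ p.1 → x ∈ P i → x = u) := by
      intro p
      obtain ⟨i, hi⟩ := hcover p.2
      by_cases hp : R p.1
      · obtain ⟨b, _, hbP, hbB, hu⟩ := IT_rep hdisj hcover (hRIT _ hp)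
        exact ⟨b i, i, fun _ => ⟨by rw [← hbB]; simp, hbP i, hi, hu i⟩⟩
      · exact ⟨p.2, i, fun h => absurd h hp⟩
    choose u q hu using hex
    have hu1 := fun p h => (hu p h).1
    have hu2 := fun p h => (hu p h).2.1
    have hu3 := fun p h => (hu p h).2.2.1
    have hu4 := fun p h => (hu p h).2.2.2
    have hmem : ∀ p : Finset V × V, (R p.1 ∧ p.2 ∉ p.1 ∧ IndepSet G (insert p.2 p.1)) →
        R ((insert p.2 p.1).erase (u p)) ∧
          insert (u p) ((insert p.2 p.1).erase (u p)) = insert p.2 p.1 := by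
      rintro p ⟨h1, h2, h3⟩
      refine ⟨h1.tail (swap hdisj hcover (hRIT _ h1) h2 (hu3 p h1) (hu1 p h1) (hu2 p h1) h3), ?_⟩
      exact Finset.insert_erase (by simp [hu1 p h1])
    refine Finset.sum_involution (fun p _ => ((insert p.2 p.1).erase (u p), u p)) ?_ ?_ ?_ ?_
    · intro p hp
      simp only [mem_filter, mem_univ, true_and] at hp
      simp only [(hmem p hp).2]
      exact CharTwo.add_self_eq_zero _
    · intro p hp _ h
      simp only [mem_filter, mem_univ, true_and] at hp
      have h2 : u p = p.2 := congrArg Prod.snd h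
      exact hp.2.1 (h2 ▸ hu1 p hp.1)
    · intro p hp
      simp only [mem_filter, mem_univ, true_and] at hp ⊢
      refine ⟨(hmem p hp).1, by simp, ?_⟩
      rw [(hmem p hp).2]
      exact hp.2.2
    · intro p hp
      simp only [mem_filter, mem_univ, true_and] at hp
      have hR' := (hmem p hp).1
      set p' : Finset V × V := ((insert p.2 p.1).erase (u p), u p) with hp'
      have hq : q p' = q p := by
        by_contra hne'
        exact Finset.disjoint_left.mp (hdisj _ _ hne') (hu3 p' hR') (hu2 p hp.1)
      have hne2 : p.2 ≠ u p := fun h => hp.2.1 (h ▸ hu1 p hp.1)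
      have hup : u p' = p.2 := by
        symm
        refine hu4 p' hR' p.2 ?_ ?_
        · simp [hp', hne2]
        · rw [hq]; exact hu3 p hp.1
      refine Prod.ext ?_ hup
      change (insert p'.2 p'.1).erase (u p') = p.1
      rw [hup, (hmem p hp).2, Finset.erase_insert hp.2.1]
  rw [hsum1] at hsum0
  exact one_ne_zero hsum0
end
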